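/- Let F be a field of characteristic p > 2, let α be a partition of n and β a one-box-shift of α with β_a = α_a − 1 and β_b = α_b + 1 for a < b, and let θ̂ : S^α → S^β be an FΣ_n-homomorphism with coefficients Λ as above. Then for every removable α-set {N} of type β, (−1)^{|N|} Λ_N = (−1)^{|R|} (∏_{u ∈ {R}∖{N}} h_u) Λ_R, where {R} is the full removable set. -/

import Mathlib

namespace CarterPayne

open Finset

/-- A partition of `n`, presented by its parts function; rows are indexed from `1`. -/
structure Partition (n : ℕ) where
  parts : ℕ → ℕ
  parts_zero : parts 0 = 0
  antitone : ∀ ⦃i j : ℕ⦄, 0 < i → i ≤ j → parts j ≤ parts i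
  finite_support : (Function.support parts).Finite
  sum_parts : ∑ᶠ i, parts i = n

variable {n : ℕ}

/-- The set of cells `(row, column)` (both 1-indexed) of the Young diagram of `μ`. -/
def Partition.cells (μ : Partition n) : Set (ℕ × ℕ) :=
  {c | 0 < c.1 ∧ 0 < c.2 ∧ c.2 ≤ μ.parts c.1}

/-- A tabloid for the composition `c` of `n`: an assignment of the `n` symbols to rows
(rows indexed from 1), row `i` receiving exactly `c i` symbols. -/
def Tabloid (n : ℕ) (c : ℕ → ℕ) : Type :=
  {g : Fin n → ℕ // ∀ i, (Finset.univ.filter fun k => g k = i).card = c i}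

/-- The permutation module `M^c` over `R`: the free `R`-module on the set of tabloids. -/
abbrev PermMod (R : Type*) [CommRing R] (n : ℕ) (c : ℕ → ℕ) := Tabloid n c →₀ R

/-- The action of a permutation of the symbols on tabloids. -/
def permTabloid (c : ℕ → ℕ) (π : Equiv.Perm (Fin n)) (f : Tabloid n c) : Tabloid n c :=
  ⟨fun k => f.1 (π.symm k), fun i => by
    rw [← f.2 i]
    exact Finset.card_equiv π.symm fun a => by simp⟩

/-- The `R`-linear action of a permutation of the symbols on `M^c`. -/
noncomputable def permM (R : Type*) [CommRing R] (c : ℕ → ℕ) (π : Equiv.Perm (Fin n)) :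
    PermMod R n c →ₗ[R] PermMod R n c :=
  Finsupp.lmapDomain R R (permTabloid c π)

/-- A bijective `μ`-tableau, presented by the placement map which sends each of the
`n` symbols to the cell of the Young diagram containing it. -/
structure Placement (μ : Partition n) where
  pos : Fin n → ℕ × ℕ
  mem : ∀ k, pos k ∈ μ.cells
  inj : Function.Injective pos
  surj : ∀ c ∈ μ.cells, ∃ k, pos k = c

/-- The column stabilizer of a bijective tableau, as a set of permutations of the symbols. -/
def colStab {μ : Partition n} (T : Placement μ) : Finset (Equiv.Perm (Fin n)) :=
  Finset.univ.filter fun π => ∀ k, (T.pos (π k)).2 = (T.pos k).2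

lemma rowFiber_card {μ : Partition n} (T : Placement μ) (i : ℕ) :
    (Finset.univ.filter fun k => (T.pos k).1 = i).card = μ.parts i := by
  classical
  have h : (Finset.univ.filter fun k => (T.pos k).1 = i).card
      = (Finset.Icc 1 (μ.parts i)).card := by
    apply Finset.card_bij (fun k _ => (T.pos k).2)
    · intro a ha
      simp only [Finset.mem_filter, Finset.mem_univ, true_and] at ha
      obtain ⟨h1, h2, h3⟩ := T.mem a
      exact Finset.mem_Icc.mpr ⟨h2, ha ▸ h3⟩
    · intro a ha b hb hab
      simp only [Finset.mem_filter, Finset.mem_univ, true_and] at ha hb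
      exact T.inj (Prod.ext (ha.trans hb.symm) hab)
    · intro j hj
      rw [Finset.mem_Icc] at hj
      have hi0 : 0 < i := by
        rcases Nat.eq_zero_or_pos i with h0 | h0
        · exfalso; rw [h0, μ.parts_zero] at hj; omega
        · exact h0
      obtain ⟨k, hk⟩ := T.surj (i, j) ⟨hi0, hj.1, hj.2⟩
      exact ⟨k, by simp [hk], by simp [hk]⟩
  rw [h, Nat.card_Icc]
  omega

/-- The row tabloid `{tπ}` associated to the bijective tableau `tπ`. -/
def rowTabloid {μ : Partition n} (T : Placement μ) (π : Equiv.Perm (Fin n)) :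
    Tabloid n μ.parts :=
  ⟨fun k => (T.pos (π k)).1, fun i => by
    rw [← rowFiber_card T i]
    exact Finset.card_equiv π fun a => by simp⟩

/-- The polytabloid `e_t` attached to a bijective tableau `t`. -/
noncomputable def polytabloid (R : Type*) [CommRing R] {μ : Partition n} (T : Placement μ) :
    PermMod R n μ.parts :=
  ∑ π ∈ colStab T, ((Equiv.Perm.sign π : ℤ) : R) • Finsupp.single (rowTabloid T π) (1 : R)

/-- The Specht module `S^μ`, the span in `M^μ` of all polytabloids. -/
noncomputable def Specht (R : Type*) [CommRing R] (μ : Partition n) :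
    Submodule R (PermMod R n μ.parts) :=
  Submodule.span R (Set.range fun T : Placement μ => polytabloid R T)

/-- `β` is obtained from the partition `α` of `n` by moving one box from
(the end of) row `a` to (the end of) row `b`; i.e. `β` is a one-box-shift of `α`. -/
structure OneBoxShift {n : ℕ} (α β : Partition n) (a b : ℕ) : Prop where
  a_pos : 0 < a
  a_lt_b : a < b
  rem : α.parts (a + 1) < α.parts a
  add : α.parts b < α.parts (b - 1)
  at_a : β.parts a = α.parts a - 1
  at_b : β.parts b = α.parts b + 1
  elsewhere : ∀ i, i ≠ a → i ≠ b → β.parts i = α.parts i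

/-- The space of `RΣ_n`-homomorphisms from `S^α` to `M^c` whose image lies in the
submodule `target` of `M^c`; an `R`-linear map is an `RΣ_n`-homomorphism when it
intertwines the permutation actions on source and target. -/
noncomputable def SpechtHom (R : Type*) [CommRing R] (α : Partition n) (c : ℕ → ℕ)
    (target : Submodule R (PermMod R n c)) :
    Submodule R (↥(Specht R α) →ₗ[R] PermMod R n c) where
  carrier := {f | (∀ x, f x ∈ target) ∧
    ∀ (π : Equiv.Perm (Fin n)) (x y : ↥(Specht R α)),
      (x : PermMod R n α.parts) = permM R α.parts π (y : PermMod R n α.parts) →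
      f x = permM R c π (f y)}
  add_mem' := by
    rintro f g ⟨hf1, hf2⟩ ⟨hg1, hg2⟩
    refine ⟨fun x => target.add_mem (hf1 x) (hg1 x), fun π x y hxy => ?_⟩
    simp only [LinearMap.add_apply, hf2 π x y hxy, hg2 π x y hxy, map_add]
  zero_mem' :=
    ⟨fun _ => target.zero_mem, fun π x y _ => by simp⟩
  smul_mem' := by
    rintro r f ⟨hf1, hf2⟩
    refine ⟨fun x => target.smul_mem r (hf1 x), fun π x y hxy => ?_⟩
    simp only [LinearMap.smul_apply, hf2 π x y hxy, map_smul]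

-- finiteness of the set of tabloids
lemma tabloid_finite (n : ℕ) (c : ℕ → ℕ) :
    {g : Fin n → ℕ | ∀ i, (Finset.univ.filter fun k => g k = i).card = c i}.Finite := by
  classical
  rcases Set.eq_empty_or_nonempty
      {g : Fin n → ℕ | ∀ i, (Finset.univ.filter fun k => g k = i).card = c i} with h | ⟨g₀, hg₀⟩
  · rw [h]; exact Set.finite_empty
  · apply Set.Finite.subset (Set.Finite.pi fun _ : Fin n => Set.finite_range g₀)
    intro g hg
    simp only [Set.mem_pi, Set.mem_univ, forall_true_left]
    intro k
    have h1 : (Finset.univ.filter fun k' => g k' = g k).card = c (g k) := hg (g k)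
    have h2 : (Finset.univ.filter fun k' => g₀ k' = g k).card = c (g k) := hg₀ (g k)
    have hp : 0 < c (g k) := by
      rw [← h1]
      exact Finset.card_pos.mpr ⟨k, by simp⟩
    rw [← h2] at hp
    obtain ⟨k', hk'⟩ := Finset.card_pos.mp hp
    simp only [Finset.mem_filter] at hk'
    exact ⟨k', hk'.2⟩

noncomputable instance (c : ℕ → ℕ) : Fintype (Tabloid n c) :=
  (tabloid_finite n c).fintype

lemma cells_finite (μ : Partition n) : μ.cells.Finite := by
  apply Set.Finite.subset (μ.finite_support.prod (Set.finite_Icc 1 (μ.parts 1)))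
  rintro ⟨i, j⟩ ⟨h1, h2, h3⟩
  refine Set.mem_prod.mpr ⟨?_, ?_⟩
  · simp only [Function.mem_support]
    intro h0
    rw [h0] at h3; omega
  · exact ⟨h2, le_trans h3 (μ.antitone Nat.one_pos h1)⟩

/-- The finset of cells of the Young diagram of `μ`. -/
noncomputable def cellFinset (μ : Partition n) : Finset (ℕ × ℕ) := (cells_finite μ).toFinset

/-- An `α`-tableau (a filling of the diagram of `α` by natural numbers) has type `c`
if the entry `j` appears exactly `c j` times. -/
def IsTypeOf (α : Partition n) (c : ℕ → ℕ) (T : ℕ × ℕ → ℕ) : Prop :=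
  ∀ j, ((cellFinset α).filter fun cc => T cc = j).card = c j

/-- A filling of the diagram of `α` is semistandard if its entries are nondecreasing
along rows and strictly increasing down columns. -/
def IsSemistandard (α : Partition n) (T : ℕ × ℕ → ℕ) : Prop :=
  (∀ i j j', (i, j) ∈ α.cells → (i, j') ∈ α.cells → j ≤ j' → T (i, j) ≤ T (i, j')) ∧
  (∀ i i' j, (i, j) ∈ α.cells → (i', j) ∈ α.cells → i < i' → T (i, j) < T (i', j))

/-- Number of entries equal to `j` in row `i` of the `α`-tableau `T`. -/
def rowContent (α : Partition n) (T : ℕ × ℕ → ℕ) (i j : ℕ) : ℕ :=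
  ((Finset.Icc 1 (α.parts i)).filter fun col => T (i, col) = j).card

open Classical in
/-- James' homomorphism `θ_T : M^α → M^c` attached to an `α`-tableau `T` of type `c`:
an `α`-tabloid `f` is sent to the sum of all `c`-tabloids `g` such that, for all `i`, `j`,
exactly `rowContent α T i j` symbols lie in row `i` of `f` and row `j` of `g`.  (This is
the sum over the row-equivalence class of `T` of the corresponding tabloids.) -/
noncomputable def theta (R : Type*) [CommRing R] (α : Partition n) (c : ℕ → ℕ)
    (T : ℕ × ℕ → ℕ) : PermMod R n α.parts →ₗ[R] PermMod R n c :=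
  Finsupp.lift (PermMod R n c) R (Tabloid n α.parts) fun f =>
    ∑ g ∈ Finset.univ.filter (fun g : Tabloid n c =>
        ∀ i j, (Finset.univ.filter fun k => f.1 k = i ∧ g.1 k = j).card = rowContent α T i j),
      Finsupp.single g (1 : R)

/-- The restriction `θ̂_T` of `θ_T` to the Specht module `S^α`. -/
noncomputable def thetaHat (R : Type*) [CommRing R] (α : Partition n) (c : ℕ → ℕ)
    (T : ℕ × ℕ → ℕ) : ↥(Specht R α) →ₗ[R] PermMod R n c :=
  (theta R α c T).comp (Specht R α).subtype

/-- The composition `ν` obtained from `c` by replacing the rows `i`, `i+1` with rows of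
sizes `c i + c (i+1) - r` and `r`. -/
def nuComp (c : ℕ → ℕ) (i r : ℕ) : ℕ → ℕ :=
  fun j => if j = i then c i + c (i + 1) - r else if j = i + 1 then r else c j

open Classical in
/-- James' homomorphism `ψ_{i,r} : M^c → M^ν`: a tabloid is sent to the sum of all
tabloids obtained from it by changing all but `r` of the entries in row `i+1` to `i`. -/
noncomputable def psi (R : Type*) [CommRing R] (c : ℕ → ℕ) (i r : ℕ) :
    PermMod R n c →ₗ[R] PermMod R n (nuComp c i r) :=
  Finsupp.lift (PermMod R n (nuComp c i r)) R (Tabloid n c) fun f =>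
    ∑ g ∈ Finset.univ.filter (fun g : Tabloid n (nuComp c i r) =>
        ∀ k, g.1 k = f.1 k ∨ (f.1 k = i + 1 ∧ g.1 k = i)),
      Finsupp.single g (1 : R)

/-- Normalized semistandard `α`-tableaux of type `c` (entries outside the diagram are `0`). -/
def SSTSet (α : Partition n) (c : ℕ → ℕ) : Set (ℕ × ℕ → ℕ) :=
  {T | IsSemistandard α T ∧ IsTypeOf α c T ∧ ∀ cc, cc ∉ α.cells → T cc = 0}

lemma SSTSet_finite (α : Partition n) (c : ℕ → ℕ) (hc : (Function.support c).Finite) :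
    (SSTSet α c).Finite := by
  classical
  have hinj : Set.InjOn (fun T (cc : ↥(cellFinset α)) => T cc.1) (SSTSet α c) := by
    intro T hT S hS h
    funext cc
    by_cases hcc : cc ∈ α.cells
    · have hmem : cc ∈ cellFinset α := (Set.Finite.mem_toFinset _).mpr hcc
      exact congrFun h ⟨cc, hmem⟩
    · rw [hT.2.2 cc hcc, hS.2.2 cc hcc]
  have himage : ((fun T (cc : ↥(cellFinset α)) => T cc.1) '' SSTSet α c) ⊆
      Set.univ.pi (fun _ : ↥(cellFinset α) => insert 0 (Function.support c)) := by
    rintro _ ⟨T, hT, rfl⟩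
    intro cc _
    have h1 := hT.2.1 (T cc.1)
    have h2 : cc.1 ∈ (cellFinset α).filter fun d => T d = T cc.1 :=
      Finset.mem_filter.mpr ⟨cc.2, rfl⟩
    have h3 : 0 < c (T cc.1) := h1 ▸ Finset.card_pos.mpr ⟨cc.1, h2⟩
    exact Set.mem_insert_iff.mpr (Or.inr (by
      simp only [Function.mem_support]
      omega))
  exact Set.Finite.of_finite_image
    (Set.Finite.subset (Set.Finite.pi fun _ => hc.insert 0) himage) hinj

/-- The finset of all (normalized) semistandard `α`-tableaux of type `β`. -/
noncomputable def sstFinset (α β : Partition n) : Finset (ℕ × ℕ → ℕ) :=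
  (SSTSet_finite α β.parts β.finite_support).toFinset

/-- `T̂(u)`, the entry at the end of row `u` of `T`. -/
def hatOf (α : Partition n) (T : ℕ × ℕ → ℕ) (u : ℕ) : ℕ := T (u, α.parts u)

/-- The semistandard `α`-set `{T}` of `T`: those rows `u ∈ {a, …, b-1}` with `T̂(u) ≠ u`. -/
def Tset (α : Partition n) (a b : ℕ) (T : ℕ × ℕ → ℕ) : Finset ℕ :=
  (Finset.Icc a (b - 1)).filter fun u => hatOf α T u ≠ u

/-- The removable set `{R}`: those rows `i ∈ {a, …, b-1}` such that `(i, α_i)` is a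
removable node of `[α]`. -/
def Rset (α : Partition n) (a b : ℕ) : Finset ℕ :=
  (Finset.Icc a (b - 1)).filter fun i => α.parts (i + 1) < α.parts i

/-- The hook lengths `h_i` in the `(α_b + 1)`-th column of `[α]` (with `h_i = 0` for `i ≥ b`):
`h_i = α_i - α_b + b - i - 1`. -/
def hook (α : Partition n) (b i : ℕ) : ℤ :=
  if i < b then (α.parts i : ℤ) - (α.parts b : ℤ) + (b : ℤ) - (i : ℤ) - 1 else 0

/-- `T̂⁻¹(v)`: the row `u ∈ {a, …, b-1}` with `T̂(u) = v`. -/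
noncomputable def invHat (α : Partition n) (a b : ℕ) (T : ℕ × ℕ → ℕ) (v : ℕ) : ℕ :=
  sInf {u | a ≤ u ∧ u ≤ b - 1 ∧ hatOf α T u = v}

/-- The smallest element of `X` greater than `u`, or `b` if there is none. -/
noncomputable def nextIn (X : Finset ℕ) (b u : ℕ) : ℕ := sInf ({v | v ∈ X ∧ u < v} ∪ {b})

/-- The bijection `T̂ : {a,…,b-1} → {a+1,…,b}` determined by a semistandard set `X`:
`T̂` maps each `u ∈ X` to the next element of `X ∪ {b}` above it, and fixes `u ∉ X`. -/
noncomputable def hatOfSet (X : Finset ℕ) (b u : ℕ) : ℕ :=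
  if u ∈ X then nextIn X b u else u

open Classical in
/-- The (normalized) semistandard `α`-tableau of type `β` whose semistandard set is `X`:
every cell of row `i` contains `i`, except that for `a ≤ i ≤ b-1` the last cell of row `i`
contains `T̂(i)` (where `T̂` is the bijection determined by `X`). -/
noncomputable def tableauOfSet (α : Partition n) (a b : ℕ) (X : Finset ℕ) : ℕ × ℕ → ℕ :=
  fun cc =>
    if cc ∈ α.cells then
      (if a ≤ cc.1 ∧ cc.1 ≤ b - 1 ∧ cc.2 = α.parts cc.1 then hatOfSet X b cc.1 else cc.1)
    else 0

/-- `X` is a semistandard `α`-set of type `β` (for the one-box shift from row `a` to row `b`):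
`a ∈ X ⊆ {a, …, b-1}`, and `u ∈ X` together with `α_{u+1} = α_u` forces `u+1 ∈ X`. -/
def IsSSSet (α : Partition n) (a b : ℕ) (X : Finset ℕ) : Prop :=
  a ∈ X ∧ (∀ u ∈ X, a ≤ u ∧ u ≤ b - 1) ∧
    ∀ u ∈ X, α.parts (u + 1) = α.parts u → u + 1 ∈ X

/-- The coefficient `(-1)^{|T|} ∏_{u ∈ {R}\{T}} h_u` of `θ̂_T` in the Carter-Payne
homomorphism. -/
noncomputable def cpCoeff (α : Partition n) (a b : ℕ) (T : ℕ × ℕ → ℕ) : ℤ :=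
  (-1) ^ (Tset α a b T).card * ∏ u ∈ Rset α a b \ Tset α a b T, hook α b u

open Classical in
/-- Coefficient of the filling `g` in the polytabloid of `s`. -/
noncomputable def polyCoeff (R : Type*) [CommRing R] {μ : Partition n} (s : Placement μ)
    (g : Fin n → ℕ) : R :=
  ∑ π ∈ colStab s, if (fun k => (s.pos (π k)).1) = g then ((Equiv.Perm.sign π : ℤ) : R) else 0

lemma polytabloid_apply (R : Type*) [CommRing R] {μ : Partition n} (s : Placement μ)
    (f : Tabloid n μ.parts) : polytabloid R s f = polyCoeff R s f.1 := by
  classical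
  unfold polytabloid polyCoeff
  rw [Finsupp.finsetSum_apply]
  refine Finset.sum_congr rfl fun π _ => ?_
  rw [Finsupp.smul_apply, Finsupp.single_apply]
  have : (rowTabloid s π = f) ↔ ((fun k => (s.pos (π k)).1) = f.1) := 
    ⟨fun h => congrArg Subtype.val h, fun h => Subtype.ext h⟩
  by_cases h : rowTabloid s π = f
  · rw [if_pos h, if_pos (this.1 h)]; simp
  · rw [if_neg h, if_neg (fun h' => h (this.2 h'))]; simp

lemma mem_colStab {μ : Partition n} (s : Placement μ) (π : Equiv.Perm (Fin n)) :
    π ∈ colStab s ↔ ∀ k, (s.pos (π k)).2 = (s.pos k).2 := by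
  simp [colStab]

lemma polyCoeff_comp (R : Type*) [CommRing R] {μ : Partition n} (s : Placement μ)
    (g : Fin n → ℕ) (σ : Equiv.Perm (Fin n)) (hσ : σ ∈ colStab s) :
    polyCoeff R s (g ∘ σ) = ((Equiv.Perm.sign σ : ℤ) : R) * polyCoeff R s g := by
  classical
  unfold polyCoeff
  rw [Finset.mul_sum]
  rw [mem_colStab] at hσ
  have hσ' : ∀ k, (s.pos (σ⁻¹ k)).2 = (s.pos k).2 := fun k => by
    have := hσ (σ⁻¹ k); simpa using this.symm
  refine Finset.sum_nbij' (fun π => π * σ⁻¹) (fun π => π * σ) ?_ ?_ ?_ ?_ ?_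
  · intro π hπ
    rw [mem_colStab] at hπ ⊢
    intro k; rw [Equiv.Perm.mul_apply, hπ, hσ']
  · intro π hπ
    rw [mem_colStab] at hπ ⊢
    intro k; rw [Equiv.Perm.mul_apply, hπ, hσ]
  · intro π _; simp
  · intro π _; simp
  · intro π _
    have : ((fun k => (s.pos (π k)).1) = g ∘ σ) ↔
        ((fun k => (s.pos ((π * σ⁻¹) k)).1) = g) := by
      constructor
      · intro h; funext k
        have := congrFun h (σ⁻¹ k)
        simpa using this
      · intro h; funext k
        have := congrFun h (σ k)
        simpa using this
    by_cases h : (fun k => (s.pos (π k)).1) = g ∘ σ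
    · rw [if_pos h, if_pos (this.1 h)]
      have h2 : ((Equiv.Perm.sign σ : ℤ)) * ((Equiv.Perm.sign σ : ℤ)) = 1 := by
        rw [← Units.val_mul, Int.units_mul_self]; rfl
      rw [← Int.cast_mul, Equiv.Perm.sign_mul, Equiv.Perm.sign_inv, Units.val_mul,
        mul_comm, mul_assoc, h2, mul_one]
    · rw [if_neg h, if_neg (fun h' => h (this.2 h')), mul_zero]

lemma swap_mem_colStab {μ : Partition n} (s : Placement μ) (x y : Fin n)
    (h : (s.pos x).2 = (s.pos y).2) : Equiv.swap x y ∈ colStab s := by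
  rw [mem_colStab]
  intro k
  by_cases hx : k = x
  · subst hx; rw [Equiv.swap_apply_left, h]
  · by_cases hy : k = y
    · subst hy; rw [Equiv.swap_apply_right, h]
    · rw [Equiv.swap_apply_of_ne_of_ne hx hy]

lemma polyCoeff_swap (R : Type*) [CommRing R] {μ : Partition n} (s : Placement μ)
    (g : Fin n → ℕ) (x y : Fin n) (hxy : x ≠ y) (h : (s.pos x).2 = (s.pos y).2) :
    polyCoeff R s (g ∘ Equiv.swap x y) = - polyCoeff R s g := by
  rw [polyCoeff_comp R s g _ (swap_mem_colStab s x y h), Equiv.Perm.sign_swap hxy]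
  simp

lemma exists_of_polyCoeff_ne (R : Type*) [CommRing R] {μ : Partition n} (s : Placement μ)
    (g : Fin n → ℕ) (h : polyCoeff R s g ≠ 0) :
    ∃ π ∈ colStab s, ∀ k, (s.pos (π k)).1 = g k := by
  classical
  obtain ⟨π, hπ, h'⟩ := Finset.exists_ne_zero_of_sum_ne_zero h
  refine ⟨π, hπ, fun k => ?_⟩
  by_contra hk
  exact h' (if_neg fun h'' => hk (congrFun h'' k))

lemma polyCoeff_repeat (R : Type*) [CommRing R] {μ : Partition n} (s : Placement μ)
    (g : Fin n → ℕ) (x y : Fin n) (hxy : x ≠ y) (h : (s.pos x).2 = (s.pos y).2)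
    (hg : g x = g y) : polyCoeff R s g = 0 := by
  by_contra h0
  obtain ⟨π, hπ, hπ2⟩ := exists_of_polyCoeff_ne R s g h0
  rw [mem_colStab] at hπ
  apply hxy
  apply π.injective
  apply s.inj
  apply Prod.ext
  · rw [hπ2, hπ2, hg]
  · rw [hπ, hπ, h]

/-- Polytabloids are annihilated by one-symbol-move functionals. -/
lemma polyCoeff_raise (R : Type*) [CommRing R] {μ : Partition n} (s : Placement μ)
    (g : Fin n → ℕ) (d d' : ℕ) (hd : 0 < d) (hdd : d < d') :
    ∑ k ∈ univ.filter (fun k => g k = d), polyCoeff R s (Function.update g k d') = 0 := by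
  classical
  by_contra h0
  obtain ⟨k0, hk0, h⟩ := Finset.exists_ne_zero_of_sum_ne_zero h0
  apply h0
  simp only [mem_filter, mem_univ, true_and] at hk0
  obtain ⟨π, hπ, hπ2⟩ := exists_of_polyCoeff_ne R s _ h
  rw [mem_colStab] at hπ
  obtain ⟨c1, c2, c3⟩ := s.mem (π k0)
  have hr : (s.pos (π k0)).1 = d' := by rw [hπ2]; simp
  obtain ⟨k1', hk1'⟩ := s.surj (d, (s.pos (π k0)).2)
    ⟨hd, c2, c3.trans (μ.antitone hd (by simp only [hr]; omega))⟩
  obtain ⟨k1, rfl⟩ := π.surjective k1'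
  have hne : k1 ≠ k0 := by
    rintro rfl
    rw [hk1'] at hr; simp at hr; omega
  have hcol : (s.pos k0).2 = (s.pos k1).2 := by
    rw [← hπ k0, ← hπ k1, hk1']
  have hg1 : g k1 = d := by
    have := hπ2 k1
    rw [hk1', Function.update_of_ne hne] at this
    exact this.symm
  rw [Finset.sum_eq_add k0 k1 hne.symm]
  · have : Function.update g k1 d' = Function.update g k0 d' ∘ Equiv.swap k0 k1 := by
      funext k
      simp only [Function.comp]
      by_cases h0 : k = k0
      · subst h0; rw [Equiv.swap_apply_left, Function.update_of_ne hne,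
          Function.update_of_ne hne.symm, hk0, hg1]
      · by_cases h1 : k = k1
        · subst h1; simp
        · rw [Equiv.swap_apply_of_ne_of_ne h0 h1, Function.update_of_ne h0, Function.update_of_ne h1]
    rw [this, polyCoeff_swap R s _ _ _ hne.symm hcol]; simp
  · intro k hk hkk
    simp only [mem_filter, mem_univ, true_and] at hk
    apply polyCoeff_repeat R s _ k0 k1 hne.symm hcol
    rw [Function.update_of_ne hkk.1.symm, Function.update_of_ne hkk.2.symm, hk0, hg1]
  · intro h; simp [hk0] at h
  · intro h; simp [hg1] at h

/-- The one-box Garnir relation. -/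
lemma polyCoeff_garnir (R : Type*) [CommRing R] {μ : Partition n} (s : Placement μ)
    (g : Fin n → ℕ) (x : Fin n) (c : ℕ) (hc : 0 < c) (hcx : c < (s.pos x).2) :
    polyCoeff R s g =
      ∑ i ∈ univ.filter (fun i => (s.pos i).2 = c), polyCoeff R s (g ∘ Equiv.swap x i) := by
  classical
  -- if some rearrangement is nonzero, find the partner in column `c`
  have key : ∀ f : Fin n → ℕ, polyCoeff R s f ≠ 0 → ∃ i, (s.pos i).2 = c ∧ f i = f x := by
    intro f hf
    obtain ⟨π, hπ, hπ2⟩ := exists_of_polyCoeff_ne R s _ hf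
    rw [mem_colStab] at hπ
    obtain ⟨c1, c2, c3⟩ := s.mem (π x)
    have := hπ x
    obtain ⟨k1', hk1'⟩ := s.surj ((s.pos (π x)).1, c) ⟨c1, hc, by simp only; omega⟩
    obtain ⟨k1, rfl⟩ := π.surjective k1'
    refine ⟨k1, ?_, ?_⟩
    · rw [← hπ k1, hk1']
    · rw [← hπ2, ← hπ2, hk1']
  have hxc : ∀ i, (s.pos i).2 = c → i ≠ x := by
    rintro i hi rfl; omega
  by_cases h : polyCoeff R s g = 0
  · rw [h]
    by_contra h0
    replace h0 := Ne.symm h0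
    obtain ⟨i, hi, hi'⟩ := Finset.exists_ne_zero_of_sum_ne_zero h0
    simp only [mem_filter, mem_univ, true_and] at hi
    apply h0
    obtain ⟨i', hci', hfi'⟩ := key _ hi'
    simp only [Function.comp, Equiv.swap_apply_left] at hfi'
    have hix := hxc i hi
    have hix' := hxc i' hci'
    have hne : i' ≠ i := by
      rintro rfl
      rw [Equiv.swap_apply_right] at hfi'
      apply hi'
      have : g ∘ Equiv.swap x i' = g := by
        funext k
        simp only [Function.comp]
        by_cases h0 : k = x
        · subst h0; rw [Equiv.swap_apply_left, hfi']
        · by_cases h1 : k = i'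
          · subst h1; rw [Equiv.swap_apply_right, hfi']
          · rw [Equiv.swap_apply_of_ne_of_ne h0 h1]
      rw [this, h]
    rw [Equiv.swap_apply_of_ne_of_ne hix' hne] at hfi'
    rw [Finset.sum_eq_add i i' hne.symm]
    · have : g ∘ Equiv.swap x i' = (g ∘ Equiv.swap x i) ∘ Equiv.swap i i' := by
        funext k
        simp only [Function.comp]
        by_cases h0 : k = x
        · subst h0
          rw [Equiv.swap_apply_of_ne_of_ne (a := i) hix.symm hix'.symm, Equiv.swap_apply_left,
            Equiv.swap_apply_left, hfi']
        · by_cases h1 : k = i'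
          · subst h1; simp
          · by_cases h2 : k = i
            · subst h2
              rw [Equiv.swap_apply_left, Equiv.swap_apply_of_ne_of_ne hix hne.symm,
                Equiv.swap_apply_of_ne_of_ne hix' hne, hfi']
            · rw [Equiv.swap_apply_of_ne_of_ne h2 h1, Equiv.swap_apply_of_ne_of_ne h0 h1,
                Equiv.swap_apply_of_ne_of_ne h0 h2]
      rw [this, polyCoeff_swap R s _ _ _ hne.symm (hi.trans hci'.symm)]; simp
    · intro k hk hkk
      simp only [mem_filter, mem_univ, true_and] at hk
      apply polyCoeff_repeat R s _ i i' hne.symm (hi.trans hci'.symm)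
      simp only [Function.comp]
      rw [Equiv.swap_apply_of_ne_of_ne hix hkk.1.symm,
        Equiv.swap_apply_of_ne_of_ne hix' hkk.2.symm, hfi']
    · intro h; simp [hi] at h
    · intro h; simp [hci'] at h
  · obtain ⟨i, hi, hgi⟩ := key g h
    have hix := hxc i hi
    rw [Finset.sum_eq_single i]
    · have : g ∘ Equiv.swap x i = g := by
        funext k
        simp only [Function.comp]
        by_cases h0 : k = x
        · subst h0; rw [Equiv.swap_apply_left, hgi]
        · by_cases h1 : k = i
          · subst h1; rw [Equiv.swap_apply_right, hgi]
          · rw [Equiv.swap_apply_of_ne_of_ne h0 h1]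
      rw [this]
    · intro k hk hki
      simp only [mem_filter, mem_univ, true_and] at hk
      apply polyCoeff_repeat R s _ i k hki.symm (hi.trans hk.symm)
      simp only [Function.comp]
      rw [Equiv.swap_apply_of_ne_of_ne hix hki.symm, Equiv.swap_apply_right, hgi]
    · intro h; simp [hi] at h

/-- `g` has type `c`. -/
def FunType (c : ℕ → ℕ) (g : Fin n → ℕ) : Prop :=
  ∀ i, (Finset.univ.filter fun k => g k = i).card = c i

open Classical in
/-- Extension by zero of an element of `M^c` to all functions. -/
noncomputable def extCoeff {R : Type*} [CommRing R] {c : ℕ → ℕ} (v : PermMod R n c)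
    (g : Fin n → ℕ) : R :=
  if h : FunType c g then v ⟨g, h⟩ else 0

lemma extCoeff_polytabloid (R : Type*) [CommRing R] {μ : Partition n} (s : Placement μ)
    (g : Fin n → ℕ) : extCoeff (polytabloid R s) g = polyCoeff R s g := by
  unfold extCoeff
  split_ifs with h
  · exact polytabloid_apply R s ⟨g, h⟩
  · by_contra h0
    obtain ⟨π, hπ, hπ2⟩ := exists_of_polyCoeff_ne R s g (Ne.symm h0)
    apply h
    have : g = (rowTabloid s π).1 := by
      funext k; exact (hπ2 k).symm
    rw [this]
    exact (rowTabloid s π).2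

lemma extCoeff_raise {R : Type*} [CommRing R] {μ : Partition n} (v : PermMod R n μ.parts)
    (hv : v ∈ Specht R μ) (g : Fin n → ℕ) (d d' : ℕ) (hd : 0 < d) (hdd : d < d') :
    ∑ k ∈ univ.filter (fun k => g k = d), extCoeff v (Function.update g k d') = 0 := by
  classical
  induction hv using Submodule.span_induction with
  | mem x hx =>
    obtain ⟨s, rfl⟩ := hx
    simp only [extCoeff_polytabloid]
    exact polyCoeff_raise R s g d d' hd hdd
  | zero =>
    apply Finset.sum_eq_zero
    intro k _
    unfold extCoeff
    split_ifs <;> rfl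
  | add x y _ _ hx hy =>
    have : ∀ f, extCoeff (x + y) f = extCoeff x f + extCoeff y f := by
      intro f; unfold extCoeff; split_ifs
      · rfl
      · simp
    simp only [this, Finset.sum_add_distrib, hx, hy, add_zero]
  | smul r x _ hx =>
    have : ∀ f, extCoeff (r • x) f = r * extCoeff x f := by
      intro f; unfold extCoeff; split_ifs
      · rfl
      · simp
    simp only [this, ← Finset.mul_sum, hx, mul_zero]

/-- The matrix of row contents of the pair `f`, `g` is that of `T`. -/
def ContentEq (α : Partition n) (T : ℕ × ℕ → ℕ) (f g : Fin n → ℕ) : Prop :=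
  ∀ i j, (Finset.univ.filter fun k => f k = i ∧ g k = j).card = rowContent α T i j

lemma contentEq_comp (α : Partition n) (T : ℕ × ℕ → ℕ) (f g : Fin n → ℕ)
    (σ : Equiv.Perm (Fin n)) : ContentEq α T (f ∘ σ) (g ∘ σ) ↔ ContentEq α T f g := by
  unfold ContentEq
  have : ∀ i j, (Finset.univ.filter fun k => (f ∘ σ) k = i ∧ (g ∘ σ) k = j).card =
      (Finset.univ.filter fun k => f k = i ∧ g k = j).card := by
    intro i j
    exact Finset.card_equiv σ fun a => by simp
  simp only [this]

lemma funType_comp (c : ℕ → ℕ) (g : Fin n → ℕ)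
    (σ : Equiv.Perm (Fin n)) : FunType c (g ∘ σ) ↔ FunType c g := by
  unfold FunType
  have : ∀ i, (Finset.univ.filter fun k => (g ∘ σ) k = i).card =
      (Finset.univ.filter fun k => g k = i).card := by
    intro i
    exact Finset.card_equiv σ fun a => by simp
  simp only [this]

open Classical in
lemma theta_apply (R : Type*) [CommRing R] (α : Partition n) (c : ℕ → ℕ)
    (T : ℕ × ℕ → ℕ) (v : PermMod R n α.parts) (g : Tabloid n c) :
    theta R α c T v g = ∑ f : Tabloid n α.parts, v f * if ContentEq α T f.1 g.1 then 1 else 0 := by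
  unfold theta
  rw [Finsupp.lift_apply, Finsupp.sum_fintype _ _ (by simp), Finsupp.finsetSum_apply]
  refine Finset.sum_congr rfl fun f _ => ?_
  rw [Finsupp.smul_apply, smul_eq_mul, Finsupp.finsetSum_apply]
  congr 1
  simp only [Finsupp.single_apply]
  rw [Finset.sum_ite_eq']
  simp only [mem_filter, mem_univ, true_and]
  rfl

open Classical in
/-- The kernel attached to the coefficients `Λ`. -/
noncomputable def kern {F : Type*} [Field F] (α β : Partition n) (Λ : (ℕ × ℕ → ℕ) → F)
    (f g : Fin n → ℕ) : F :=
  if FunType β.parts g then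
    ∑ T ∈ sstFinset α β, Λ T * (if ContentEq α T f g then 1 else 0) else 0

lemma kern_comp {F : Type*} [Field F] (α β : Partition n) (Λ : (ℕ × ℕ → ℕ) → F)
    (f g : Fin n → ℕ) (σ : Equiv.Perm (Fin n)) :
    kern α β Λ (f ∘ σ) (g ∘ σ) = kern α β Λ f g := by
  classical
  unfold kern
  have h1 := funType_comp β.parts g σ
  have h2 : ∀ T, (if ContentEq α T (f ∘ σ) (g ∘ σ) then (1 : F) else 0) =
      if ContentEq α T f g then 1 else 0 := fun T => by
    have := contentEq_comp α T f g σ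
    by_cases h : ContentEq α T f g
    · rw [if_pos h, if_pos (this.2 h)]
    · rw [if_neg h, if_neg (fun h' => h (this.1 h'))]
  by_cases h : FunType β.parts g
  · rw [if_pos h, if_pos (h1.2 h)]
    exact Finset.sum_congr rfl fun T _ => by rw [h2]
  · rw [if_neg h, if_neg (fun h' => h (h1.1 h'))]

/-- The coefficient functional of the image of a polytabloid. -/
noncomputable def imgCoeff {F : Type*} [Field F] (α β : Partition n) (Λ : (ℕ × ℕ → ℕ) → F)
    (t : Placement α) (g : Fin n → ℕ) : F :=
  ∑ f : Tabloid n α.parts, polyCoeff F t f.1 * kern α β Λ f.1 g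

lemma imgCoeff_eq {F : Type*} [Field F] (α β : Partition n) (Λ : (ℕ × ℕ → ℕ) → F)
    (t : Placement α) (θ : ↥(Specht F α) →ₗ[F] PermMod F n β.parts)
    (hΛ : θ = ∑ T ∈ sstFinset α β, Λ T • thetaHat F α β.parts T)
    (ht : polytabloid F t ∈ Specht F α) (g : Fin n → ℕ) :
    imgCoeff α β Λ t g = extCoeff (θ ⟨polytabloid F t, ht⟩) g := by
  classical
  unfold imgCoeff extCoeff kern
  split_ifs with h
  · have hs : ∀ gt : Tabloid n β.parts,
        ∑ f : Tabloid n α.parts, polyCoeff F t f.1 *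
          ∑ T ∈ sstFinset α β, Λ T * (if ContentEq α T f.1 gt.1 then 1 else 0) =
        (θ ⟨polytabloid F t, ht⟩) gt := by
      intro gt
      rw [hΛ, LinearMap.sum_apply, Finsupp.finsetSum_apply]
      simp only [Finset.mul_sum]
      rw [Finset.sum_comm]
      refine Finset.sum_congr rfl fun T _ => ?_
      rw [LinearMap.smul_apply, Finsupp.smul_apply, smul_eq_mul]
      have : (thetaHat F α β.parts T) ⟨polytabloid F t, ht⟩ =
        theta F α β.parts T (polytabloid F t) := rfl
      rw [this, theta_apply, Finset.mul_sum]
      refine Finset.sum_congr rfl fun f _ => ?_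
      rw [polytabloid_apply]
      ring
    exact hs ⟨g, h⟩
  · simp

lemma imgCoeff_comp {F : Type*} [Field F] (α β : Partition n) (Λ : (ℕ × ℕ → ℕ) → F)
    (t : Placement α) (g : Fin n → ℕ) (σ : Equiv.Perm (Fin n)) :
    imgCoeff α β Λ t (g ∘ σ) =
      ∑ f : Tabloid n α.parts, polyCoeff F t (f.1 ∘ σ) * kern α β Λ f.1 g := by
  unfold imgCoeff
  refine Finset.sum_nbij' (fun f => permTabloid _ σ f) (fun f => permTabloid _ σ.symm f)
    (by simp) (by simp) ?_ ?_ ?_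
  · intro f _
    apply Subtype.ext; funext k; simp [permTabloid]
  · intro f _
    apply Subtype.ext; funext k; simp [permTabloid]
  · intro f _
    have h : (permTabloid _ σ f).1 ∘ σ = f.1 := by
      funext k; simp [permTabloid]
    rw [h, ← kern_comp α β Λ _ g σ, h]

lemma imgCoeff_swap {F : Type*} [Field F] (α β : Partition n) (Λ : (ℕ × ℕ → ℕ) → F)
    (t : Placement α) (g : Fin n → ℕ) (x y : Fin n) (hxy : x ≠ y)
    (h : (t.pos x).2 = (t.pos y).2) :
    imgCoeff α β Λ t (g ∘ Equiv.swap x y) = - imgCoeff α β Λ t g := by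
  rw [imgCoeff_comp]
  unfold imgCoeff
  rw [← Finset.sum_neg_distrib]
  refine Finset.sum_congr rfl fun f _ => ?_
  rw [polyCoeff_swap F t _ x y hxy h]; ring

lemma imgCoeff_garnir {F : Type*} [Field F] (α β : Partition n) (Λ : (ℕ × ℕ → ℕ) → F)
    (t : Placement α) (g : Fin n → ℕ) (x : Fin n) (c : ℕ) (hc : 0 < c)
    (hcx : c < (t.pos x).2) :
    imgCoeff α β Λ t g =
      ∑ i ∈ univ.filter (fun i => (t.pos i).2 = c),
        imgCoeff α β Λ t (g ∘ Equiv.swap x i) := by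
  simp only [imgCoeff_comp]
  rw [Finset.sum_comm]
  unfold imgCoeff
  refine Finset.sum_congr rfl fun f _ => ?_
  rw [← Finset.sum_mul, ← polyCoeff_garnir F t _ x c hc hcx]

lemma exists_placement (α : Partition n) : Nonempty (Placement α) := by
  classical
  have hcard : (cellFinset α).card = n := by
    have h1 : (cellFinset α).card = ∑ i ∈ α.finite_support.toFinset, α.parts i := by
      have hm : ∀ c ∈ cellFinset α, c.1 ∈ α.finite_support.toFinset := by
        intro c hc
        obtain ⟨h1, h2, h3⟩ := (Set.Finite.mem_toFinset _).1 hc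
        simp only [Set.Finite.mem_toFinset, Function.mem_support]
        omega
      rw [Finset.card_eq_sum_card_fiberwise hm]
      refine Finset.sum_congr rfl fun i _ => ?_
      have : (cellFinset α).filter (fun c => c.1 = i) =
          (Finset.Icc 1 (α.parts i)).image fun j => (i, j) := by
        ext ⟨x, y⟩
        simp only [cellFinset, mem_filter, Set.Finite.mem_toFinset, Partition.cells,
          Set.mem_ofPred_eq, mem_image, Finset.mem_Icc, Prod.mk.injEq]
        constructor
        · rintro ⟨⟨h1, h2, h3⟩, rfl⟩; exact ⟨y, ⟨h2, h3⟩, rfl, rfl⟩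
        · rintro ⟨j, ⟨h1, h2⟩, rfl, rfl⟩
          refine ⟨⟨?_, h1, h2⟩, rfl⟩
          rcases Nat.eq_zero_or_pos i with h0 | h0
          · rw [h0, α.parts_zero] at h2; omega
          · exact h0
      rw [this, Finset.card_image_of_injective _ (fun x y h => by simpa using h), Nat.card_Icc]
      omega
    rw [h1, ← finsum_eq_sum _ α.finite_support, α.sum_parts]
  let e : Fin n ≃ cellFinset α := (Fintype.equivFinOfCardEq (by simp [hcard])).symm
  refine ⟨⟨fun k => (e k).1, fun k => ?_, fun x y h => e.injective (Subtype.ext h), ?_⟩⟩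
  · exact (Set.Finite.mem_toFinset _).1 (e k).2
  · intro c hc
    refine ⟨e.symm ⟨c, (Set.Finite.mem_toFinset _).2 hc⟩, by simp⟩

lemma mem_cellFinset (α : Partition n) (c : ℕ × ℕ) : c ∈ cellFinset α ↔ c ∈ α.cells :=
  Set.Finite.mem_toFinset _

lemma mem_sstFinset (α β : Partition n) (T : ℕ × ℕ → ℕ) :
    T ∈ sstFinset α β ↔ T ∈ SSTSet α β.parts :=
  Set.Finite.mem_toFinset _

lemma sst_ge_row (α β : Partition n) (T : ℕ × ℕ → ℕ) (hT : T ∈ SSTSet α β.parts) (i j : ℕ)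
    (h : (i, j) ∈ α.cells) : i ≤ T (i, j) := by
  induction i with
  | zero => omega
  | succ i ih =>
    obtain ⟨h1, h2, h3⟩ := h
    simp only at h1 h2 h3
    rcases Nat.eq_zero_or_pos i with h0 | h0
    · subst h0
      by_contra hlt
      have h4 := hT.2.1 0
      rw [β.parts_zero, Finset.card_eq_zero] at h4
      have h5 : (0 + 1, j) ∈ (cellFinset α).filter (fun cc => T cc = 0) := by
        rw [mem_filter, mem_cellFinset]
        exact ⟨⟨h1, h2, h3⟩, by omega⟩
      rw [h4] at h5; simp at h5
    · have hc : (i, j) ∈ α.cells := ⟨h0, h2, h3.trans (α.antitone h0 (by omega))⟩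
      have := ih hc
      have := hT.1.2 i (i + 1) j hc ⟨h1, h2, h3⟩ (by omega)
      omega

lemma rows_le_of_content (α : Partition n) (T S : ℕ × ℕ → ℕ) (hT : IsSemistandard α T)
    (hS : IsSemistandard α S) (h : ∀ i j, rowContent α T i j = rowContent α S i j)
    (i c : ℕ) (hc : (i, c) ∈ α.cells) : S (i, c) ≤ T (i, c) := by
  classical
  by_contra hlt
  obtain ⟨h1, h2, h3⟩ := hc
  simp only at h1 h2 h3
  have hcount : ∀ U : ℕ × ℕ → ℕ,
      ((Icc 1 (α.parts i)).filter fun col => U (i, col) ≤ T (i, c)).card =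
      ∑ j ∈ range (T (i, c) + 1), rowContent α U i j := by
    intro U
    rw [Finset.card_eq_sum_card_fiberwise (f := fun col => U (i, col))
      (t := range (T (i, c) + 1))]
    · refine Finset.sum_congr rfl fun j hj => ?_
      unfold rowContent
      rw [Finset.filter_filter]
      congr 1
      ext col
      simp only [mem_filter, mem_Icc, mem_range] at hj ⊢
      constructor
      · rintro ⟨a, b, c⟩; exact ⟨a, c⟩
      · rintro ⟨a, b⟩; exact ⟨a, by omega, b⟩
    · intro col hcol
      simp only [coe_filter, mem_Icc, Set.mem_ofPred_eq, coe_range, Set.mem_Iio] at hcol ⊢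
      omega
  have e : ((Icc 1 (α.parts i)).filter fun col => T (i, col) ≤ T (i, c)).card =
      ((Icc 1 (α.parts i)).filter fun col => S (i, col) ≤ T (i, c)).card := by
    rw [hcount, hcount]
    exact Finset.sum_congr rfl fun j _ => h i j
  have a1 : (Icc 1 c).card ≤
      ((Icc 1 (α.parts i)).filter fun col => T (i, col) ≤ T (i, c)).card := by
    apply Finset.card_le_card
    intro col hcol
    simp only [mem_Icc, mem_filter] at hcol ⊢
    exact ⟨⟨hcol.1, by omega⟩, hT.1 i col c ⟨h1, hcol.1, by simp only; omega⟩ ⟨h1, h2, h3⟩ hcol.2⟩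
  have a2 : ((Icc 1 (α.parts i)).filter fun col => S (i, col) ≤ T (i, c)).card ≤
      (Icc 1 (c - 1)).card := by
    apply Finset.card_le_card
    intro col hcol
    simp only [mem_Icc, mem_filter] at hcol ⊢
    refine ⟨hcol.1.1, ?_⟩
    by_contra hh
    have := hS.1 i c col ⟨h1, h2, h3⟩ ⟨h1, hcol.1.1, hcol.1.2⟩ (by omega)
    omega
  simp only [Nat.card_Icc] at a1 a2
  omega

lemma content_pos (α : Partition n) (t : Placement α) (G : ℕ × ℕ → ℕ) :
    ∀ i j, (Finset.univ.filter fun k => (t.pos k).1 = i ∧ (G ∘ t.pos) k = j).card =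
      rowContent α G i j := by
  intro i j
  unfold rowContent
  refine Finset.card_bij (fun k _ => (t.pos k).2) ?_ ?_ ?_
  · intro k hk
    simp only [mem_filter, mem_univ, true_and, Function.comp, mem_Icc] at hk ⊢
    obtain ⟨h1, h2, h3⟩ := t.mem k
    obtain ⟨rfl, rfl⟩ := hk
    exact ⟨⟨h2, h3⟩, rfl⟩
  · intro x hx y hy hxy
    simp only [mem_filter, mem_univ, true_and] at hx hy
    exact t.inj (Prod.ext (hx.1.trans hy.1.symm) hxy)
  · intro c hc
    simp only [mem_filter, mem_Icc] at hc
    have hi : 0 < i := by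
      rcases Nat.eq_zero_or_pos i with h0 | h0
      · rw [h0, α.parts_zero] at hc; omega
      · exact h0
    obtain ⟨k, hk⟩ := t.surj (i, c) ⟨hi, hc.1.1, hc.1.2⟩
    exact ⟨k, by simp [hk, hc.2], by simp [hk]⟩

lemma funType_pos (α : Partition n) (c : ℕ → ℕ) (t : Placement α) (G : ℕ × ℕ → ℕ)
    (hG : IsTypeOf α c G) : FunType c (G ∘ t.pos) := by
  intro j
  rw [← hG j]
  refine Finset.card_bij (fun k _ => t.pos k) ?_ ?_ ?_
  · intro k hk
    simp only [mem_filter, mem_univ, true_and, Function.comp] at hk ⊢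
    exact ⟨(mem_cellFinset _ _).2 (t.mem k), hk⟩
  · intro x _ y _ hxy
    exact t.inj hxy
  · intro c hc
    simp only [mem_filter, mem_cellFinset] at hc
    obtain ⟨k, hk⟩ := t.surj c hc.1
    exact ⟨k, by simp [hk, hc.2], hk⟩

lemma imgCoeff_eval {F : Type*} [Field F] (α β : Partition n) (Λ : (ℕ × ℕ → ℕ) → F)
    (t : Placement α) (G : ℕ × ℕ → ℕ) (hG : G ∈ SSTSet α β.parts)
    (hG2 : ∀ i j, (i, j) ∈ α.cells → (i + 1, j) ∈ α.cells → G (i, j) = i) :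
    imgCoeff α β Λ t (G ∘ t.pos) = Λ G := by
  classical
  have hexp : imgCoeff α β Λ t (G ∘ t.pos) = ∑ π ∈ colStab t,
      ((Equiv.Perm.sign π : ℤ) : F) * kern α β Λ (fun k => (t.pos (π k)).1) (G ∘ t.pos) := by
    unfold imgCoeff polyCoeff
    simp only [Finset.sum_mul]
    rw [Finset.sum_comm]
    refine Finset.sum_congr rfl fun π _ => ?_
    rw [Finset.sum_eq_single (rowTabloid t π)]
    · exact congrArg (· * _) (if_pos rfl)
    · intro f _ hf
      rw [if_neg, zero_mul]
      intro h
      exact hf (Subtype.ext h.symm)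
    · simp
  have hpi : ∀ π ∈ colStab t, ∀ T ∈ SSTSet α β.parts,
      ContentEq α T (fun k => (t.pos (π k)).1) (G ∘ t.pos) → π = 1 := by
    intro π hπ T hT hc
    rw [mem_colStab] at hπ
    have h1 : ∀ k, (t.pos (π k)).1 ≤ G (t.pos k) := by
      intro k
      have h2 := hc (t.pos (π k)).1 (G (t.pos k))
      have h3 : 0 < rowContent α T (t.pos (π k)).1 (G (t.pos k)) := by
        rw [← h2]
        exact Finset.card_pos.2 ⟨k, by simp⟩
      obtain ⟨col, hcol⟩ := Finset.card_pos.1 h3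
      simp only [mem_filter, mem_Icc] at hcol
      rw [← hcol.2]
      exact sst_ge_row α β T hT _ _ ⟨(t.mem (π k)).1, hcol.1.1, hcol.1.2⟩
    have h2 : ∀ k, (t.pos (π k)).1 ≤ (t.pos k).1 := by
      intro k
      by_contra hlt
      have hm := t.mem (π k)
      obtain ⟨m1, m2, m3⟩ := hm
      have := hG2 (t.pos k).1 (t.pos k).2 (t.mem k) ⟨by simp, (t.mem k).2.1, by
        rw [hπ] at m3
        exact m3.trans (α.antitone (by simp) (by simp only; omega))⟩
      have h3 := h1 k
      simp only [Prod.mk.eta] at this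
      omega
    have h3 : ∑ k, (t.pos (π k)).1 = ∑ k, (t.pos k).1 :=
      Equiv.sum_comp π fun k => (t.pos k).1
    have h4 := (Finset.sum_eq_sum_iff_of_le (fun k _ => h2 k)).1 h3
    ext k
    have : π k = k := t.inj (Prod.ext (h4 k (mem_univ _)) (hπ k))
    simp [this]
  rw [hexp, Finset.sum_eq_single 1]
  · unfold kern
    rw [if_pos (funType_pos α _ t G hG.2.1), Finset.sum_eq_single G]
    · rw [if_pos]
      · simp
      · exact content_pos α t G
    · intro T hT hTG
      rw [if_neg, mul_zero]
      intro hc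
      apply hTG
      rw [mem_sstFinset] at hT
      have e : ∀ i j, rowContent α G i j = rowContent α T i j := by
        intro i j
        rw [← hc i j, ← content_pos α t G i j]; rfl
      funext cc
      by_cases hcc : cc ∈ α.cells
      · exact le_antisymm (rows_le_of_content α G T hG.1 hT.1 e cc.1 cc.2 hcc)
          (rows_le_of_content α T G hT.1 hG.1 (fun i j => (e i j).symm) cc.1 cc.2 hcc)
      · rw [hT.2.2 cc hcc, hG.2.2 cc hcc]
    · intro h; exact absurd ((mem_sstFinset _ _ _).2 hG) h
  · intro π hπ hne
    unfold kern
    rw [if_pos (funType_pos α _ t G hG.2.1), Finset.sum_eq_zero, mul_zero]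
    intro T hT
    rw [if_neg, mul_zero]
    intro hc
    exact hne (hpi π hπ T ((mem_sstFinset _ _ _).1 hT) hc)
  · intro h
    exact absurd ((mem_colStab t 1).2 (by simp)) h

/-- The relations satisfied by the coefficients of the image of a polytabloid,
in terms of fillings of the diagram. -/
structure Functional {F : Type*} [Field F] (α β : Partition n) (Λ : (ℕ × ℕ → ℕ) → F)
    (U : (ℕ × ℕ → ℕ) → F) : Prop where
  congr : ∀ G H : ℕ × ℕ → ℕ, (∀ c ∈ α.cells, G c = H c) → U G = U H
  swap : ∀ (G : ℕ × ℕ → ℕ) (i i' j : ℕ), (i, j) ∈ α.cells → (i', j) ∈ α.cells → i ≠ i' →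
    U (G ∘ Equiv.swap (i, j) (i', j)) = - U G
  rep : ∀ (G : ℕ × ℕ → ℕ) (i i' j : ℕ), (i, j) ∈ α.cells → (i', j) ∈ α.cells → i ≠ i' →
    G (i, j) = G (i', j) → U G = 0
  raise : ∀ (G : ℕ × ℕ → ℕ) (d d' : ℕ), 0 < d → d < d' →
    ∑ c ∈ (cellFinset α).filter (fun c => G c = d), U (Function.update G c d') = 0
  garnir : ∀ (G : ℕ × ℕ → ℕ) (x : ℕ × ℕ) (c : ℕ), x ∈ α.cells → 0 < c → c < x.2 →
    U G = ∑ y ∈ (cellFinset α).filter (fun y => y.2 = c), U (G ∘ Equiv.swap x y)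
  eval : ∀ G : ℕ × ℕ → ℕ, G ∈ SSTSet α β.parts →
    (∀ i j, (i, j) ∈ α.cells → (i + 1, j) ∈ α.cells → G (i, j) = i) → U G = Λ G

lemma exists_functional (F : Type*) [Field F] (p : ℕ) [CharP F p] (hp : 2 < p)
    (α β : Partition n)
    (θ : ↥(Specht F α) →ₗ[F] PermMod F n β.parts)
    (hθ : θ ∈ SpechtHom F α β.parts (Specht F β))
    (Λ : (ℕ × ℕ → ℕ) → F)
    (hΛ : θ = ∑ T ∈ sstFinset α β, Λ T • thetaHat F α β.parts T) :
    ∃ U, Functional α β Λ U := by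
  classical
  obtain ⟨t⟩ := exists_placement α
  have ht : polytabloid F t ∈ Specht F α := Submodule.subset_span ⟨t, rfl⟩
  have h2 : (2 : F) ≠ 0 := by
    intro h
    have := (CharP.cast_eq_zero_iff F p 2).1 (by exact_mod_cast h)
    have := Nat.le_of_dvd (by norm_num) this
    omega
  have hsw : ∀ (G : ℕ × ℕ → ℕ) (i i' j : ℕ), (i, j) ∈ α.cells → (i', j) ∈ α.cells → i ≠ i' →
      imgCoeff α β Λ t ((G ∘ Equiv.swap (i, j) (i', j)) ∘ t.pos) =
        - imgCoeff α β Λ t (G ∘ t.pos) := by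
    intro G i i' j h h' hii
    obtain ⟨k, hk⟩ := t.surj _ h
    obtain ⟨k', hk'⟩ := t.surj _ h'
    rw [← hk, ← hk', Function.comp_assoc, t.inj.swap_comp, ← Function.comp_assoc]
    apply imgCoeff_swap
    · rintro rfl
      rw [hk] at hk'
      simp at hk'; exact hii hk'
    · rw [hk, hk']
  refine ⟨fun G => imgCoeff α β Λ t (G ∘ t.pos), ?_, hsw, ?_, ?_, ?_, ?_⟩
  · intro G H h
    have : G ∘ t.pos = H ∘ t.pos := by
      funext k; exact h _ (t.mem k)
    simp only [this]
  · intro G i i' j h h' hii hG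
    have e : G ∘ Equiv.swap (i, j) (i', j) = G := by
      funext k
      simp only [Function.comp]
      by_cases h0 : k = (i, j)
      · rw [h0, Equiv.swap_apply_left, hG]
      · by_cases h1 : k = (i', j)
        · rw [h1, Equiv.swap_apply_right, hG]
        · rw [Equiv.swap_apply_of_ne_of_ne h0 h1]
    have := hsw G i i' j h h' hii
    rw [e] at this
    have h3 : 2 * imgCoeff α β Λ t (G ∘ t.pos) = 0 := by linear_combination this
    exact (mul_eq_zero.1 h3).resolve_left h2
  · intro G d d' hd hdd
    have h3 := extCoeff_raise (θ ⟨polytabloid F t, ht⟩) (hθ.1 _) (G ∘ t.pos) d d' hd hdd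
    simp only [← imgCoeff_eq α β Λ t θ hΛ ht] at h3
    rw [← h3]
    symm
    refine Finset.sum_bij (fun k _ => t.pos k) ?_ ?_ ?_ ?_
    · intro k hk
      simp only [mem_filter, mem_univ, true_and, Function.comp] at hk ⊢
      exact ⟨(mem_cellFinset _ _).2 (t.mem k), hk⟩
    · intro x _ y _ hxy
      exact t.inj hxy
    · intro c hc
      simp only [mem_filter, mem_cellFinset] at hc
      obtain ⟨k, hk⟩ := t.surj c hc.1
      exact ⟨k, by simp [hk, hc.2], hk⟩
    · intro k _
      rw [Function.update_comp_eq_of_injective G t.inj]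
  · intro G x c hx hc hcx
    obtain ⟨k, rfl⟩ := t.surj _ hx
    rw [imgCoeff_garnir α β Λ t _ k c hc hcx]
    refine Finset.sum_bij (fun k _ => t.pos k) ?_ ?_ ?_ ?_
    · intro k hk
      simp only [mem_filter, mem_univ, true_and] at hk ⊢
      exact ⟨(mem_cellFinset _ _).2 (t.mem k), hk⟩
    · intro x _ y _ hxy
      exact t.inj hxy
    · intro c hc
      simp only [mem_filter, mem_cellFinset] at hc
      obtain ⟨k, hk⟩ := t.surj c hc.1
      exact ⟨k, by simp [hk, hc.2], hk⟩
    · intro k' _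
      rw [Function.comp_assoc, Function.comp_assoc, ← t.inj.swap_comp]
  · intro G hG hG2
    exact imgCoeff_eval α β Λ t G hG hG2

lemma nextIn_spec (X : Finset ℕ) (b u : ℕ) (hX : ∀ v ∈ X, v < b) (hu : u < b) :
    u < nextIn X b u ∧ nextIn X b u ≤ b ∧ (nextIn X b u ∈ X ∨ nextIn X b u = b) ∧
      ∀ v ∈ X, u < v → nextIn X b u ≤ v := by
  have hmem : nextIn X b u ∈ ({v | v ∈ X ∧ u < v} ∪ {b} : Set ℕ) :=
    Nat.sInf_mem ⟨b, Or.inr rfl⟩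
  refine ⟨?_, Nat.sInf_le (Or.inr rfl), ?_, fun v hv huv => Nat.sInf_le (Or.inl ⟨hv, huv⟩)⟩
  · rcases hmem with h | h
    · exact h.2
    · rw [Set.mem_singleton_iff] at h; omega
  · rcases hmem with h | h
    · exact Or.inl h.1
    · exact Or.inr h

lemma nextIn_eq (X : Finset ℕ) (b u q : ℕ) (hX : ∀ v ∈ X, v < b) (hu : u < b)
    (h1 : u < q) (h2 : q ≤ b) (h3 : q ∈ X ∨ q = b) (h4 : ∀ v ∈ X, u < v → q ≤ v) :
    nextIn X b u = q := by
  obtain ⟨a1, a2, a3, a4⟩ := nextIn_spec X b u hX hu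
  apply le_antisymm
  · rcases h3 with h | h
    · exact a4 q h h1
    · omega
  · rcases a3 with h | h
    · exact h4 _ h a1
    · omega

lemma mem_Rset {α : Partition n} {a b i : ℕ} (hb : a < b) :
    i ∈ Rset α a b ↔ a ≤ i ∧ i < b ∧ α.parts (i + 1) < α.parts i := by
  unfold Rset
  rw [mem_filter, mem_Icc]
  constructor
  · rintro ⟨⟨h1, h2⟩, h3⟩; exact ⟨h1, by omega, h3⟩
  · rintro ⟨h1, h2, h3⟩; exact ⟨⟨h1, by omega⟩, h3⟩

lemma tab_end {α : Partition n} {a b : ℕ} (ha : 0 < a) (hb : a < b) {X : Finset ℕ}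
    (hX : X ⊆ Rset α a b) {i : ℕ} (hi : i ∈ X) :
    tableauOfSet α a b X (i, α.parts i) = nextIn X b i := by
  obtain ⟨h1, h2, h3⟩ := (mem_Rset hb).1 (hX hi)
  unfold tableauOfSet hatOfSet
  rw [if_pos, if_pos, if_pos hi]
  · exact ⟨h1, by simp only; omega, rfl⟩
  · exact ⟨by simp only; omega, by simp only; omega, le_refl _⟩

lemma tab_other {α : Partition n} {a b : ℕ} {X : Finset ℕ} {i j : ℕ} (hc : (i, j) ∈ α.cells)
    (h : i ∈ X → j ≠ α.parts i) : tableauOfSet α a b X (i, j) = i := by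
  unfold tableauOfSet hatOfSet
  rw [if_pos hc]
  split_ifs with h1 h2
  · exact absurd h1.2.2 (h h2)
  · rfl
  · rfl

lemma tab_ge {α : Partition n} {a b : ℕ} (ha : 0 < a) (hb : a < b) {X : Finset ℕ}
    (hX : X ⊆ Rset α a b) {i j : ℕ} (hc : (i, j) ∈ α.cells) :
    i ≤ tableauOfSet α a b X (i, j) := by
  by_cases h : i ∈ X ∧ j = α.parts i
  · obtain ⟨h1, rfl⟩ := h
    rw [tab_end ha hb hX h1]
    exact (nextIn_spec X b i (fun v hv => ((mem_Rset hb).1 (hX hv)).2.1)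
      ((mem_Rset hb).1 (hX h1)).2.1).1.le
  · rw [tab_other hc (by tauto)]

lemma tab_upper {α : Partition n} {a b : ℕ} (hb : a < b) {X : Finset ℕ}
    (hX : X ⊆ Rset α a b) {i i' j : ℕ} (hc : (i, j) ∈ α.cells) (hc' : (i', j) ∈ α.cells)
    (h : i < i') : tableauOfSet α a b X (i, j) = i := by
  apply tab_other hc
  rintro hi rfl
  obtain ⟨h1, h2, h3⟩ := (mem_Rset hb).1 (hX hi)
  have h4 : α.parts i ≤ α.parts i' := hc'.2.2
  have := α.antitone (by omega : 0 < i + 1) (by omega : i + 1 ≤ i')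
  omega

lemma next_count {a b : ℕ} (hb : a < b) (X : Finset ℕ) (haX : a ∈ X)
    (hX : ∀ v ∈ X, a ≤ v ∧ v < b) (j : ℕ) :
    (X.filter fun i => nextIn X b i = j).card = if (j ∈ X ∧ j ≠ a) ∨ j = b then 1 else 0 := by
  have hXb : ∀ v ∈ X, v < b := fun v hv => (hX v hv).2
  split_ifs with h
  · have haj : a < j := by
      rcases h with h | h
      · have := hX j h.1; omega
      · omega
    have hjb : j ≤ b := by
      rcases h with h | h
      · exact (hXb j h.1).le
      · omega
    have hne : (X.filter fun i => i < j).Nonempty := ⟨a, by simp [haX, haj]⟩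
    obtain ⟨m, hm, hmax⟩ := Finset.exists_max_image _ id hne
    simp only [mem_filter, id] at hm hmax
    rw [Finset.card_eq_one]
    refine ⟨m, ?_⟩
    ext i
    simp only [mem_filter, mem_singleton]
    constructor
    · rintro ⟨hi, hij⟩
      obtain ⟨a1, a2, a3, a4⟩ := nextIn_spec X b i hXb (hXb i hi)
      have h1 := hmax i ⟨hi, by omega⟩
      by_contra hne
      have := a4 m hm.1 (by omega)
      omega
    · rintro rfl
      refine ⟨hm.1, nextIn_eq X b i j hXb (hXb i hm.1) hm.2 hjb (by tauto) ?_⟩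
      intro v hv hiv
      by_contra hlt
      have := hmax v ⟨hv, by omega⟩
      omega
  · rw [Finset.card_eq_zero, Finset.filter_eq_empty_iff]
    intro i hi hij
    obtain ⟨a1, a2, a3, a4⟩ := nextIn_spec X b i hXb (hXb i hi)
    have := hX i hi
    apply h
    rcases a3 with a3 | a3
    · left; rw [← hij]; exact ⟨a3, by omega⟩
    · right; omega

lemma tab_type {α β : Partition n} {a b : ℕ} (hs : OneBoxShift α β a b) {X : Finset ℕ}
    (hX : X ⊆ Rset α a b) (haX : a ∈ X) : IsTypeOf α β.parts (tableauOfSet α a b X) := by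
  classical
  have ha := hs.a_pos
  have hb := hs.a_lt_b
  intro j
  have hXX : ∀ v ∈ X, a ≤ v ∧ v < b ∧ α.parts (v + 1) < α.parts v :=
    fun v hv => (mem_Rset hb).1 (hX hv)
  have hset : (cellFinset α).filter (fun cc => tableauOfSet α a b X cc = j) =
      ((Icc 1 (if j ∈ X then α.parts j - 1 else α.parts j)).image fun c => (j, c)) ∪
      ((X.filter fun i => nextIn X b i = j).image fun i => (i, α.parts i)) := by
    ext ⟨x, y⟩
    simp only [mem_filter, mem_cellFinset, mem_union, mem_image, mem_Icc, Prod.mk.injEq]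
    constructor
    · rintro ⟨hc, hT⟩
      by_cases h : x ∈ X ∧ y = α.parts x
      · obtain ⟨h1, rfl⟩ := h
        rw [tab_end ha hb hX h1] at hT
        exact Or.inr ⟨x, ⟨h1, hT⟩, rfl, rfl⟩
      · rw [tab_other hc (by tauto)] at hT
        subst hT
        have h3 : y ≤ α.parts x := hc.2.2
        have h2 : 0 < y := hc.2.1
        refine Or.inl ⟨y, ⟨h2, ?_⟩, rfl, rfl⟩
        split_ifs with hx
        · have : y ≠ α.parts x := fun hy => h ⟨hx, hy⟩
          omega
        · exact h3
    · rintro (⟨c, ⟨h1, h2⟩, rfl, rfl⟩ | ⟨i, ⟨h1, h2⟩, rfl, rfl⟩)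
      · have hj : 0 < j := by
          rcases Nat.eq_zero_or_pos j with h0 | h0
          · have := α.parts_zero
            subst h0
            split_ifs at h2 <;> omega
          · exact h0
        have hc : (j, c) ∈ α.cells := ⟨hj, h1, by
          simp only; split_ifs at h2 <;> omega⟩
        refine ⟨hc, tab_other hc ?_⟩
        intro hjX
        rw [if_pos hjX] at h2
        omega
      · obtain ⟨b1, b2, b3⟩ := hXX i h1
        exact ⟨⟨by simp only; omega, by simp only; omega, le_refl _⟩, by rw [tab_end ha hb hX h1, h2]⟩
  rw [hset, Finset.card_union_of_disjoint, Finset.card_image_of_injective _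
    (fun x y h => by simpa using h), Finset.card_image_of_injective _
    (fun x y h => by simp at h; exact h.1), next_count hb X haX (fun v hv =>
      ⟨(hXX v hv).1, (hXX v hv).2.1⟩), Nat.card_Icc]
  · have hbX : b ∉ X := fun h => by have := hXX b h; omega
    by_cases hja : j = a
    · subst hja
      rw [hs.at_a, if_pos haX, if_neg]
      · omega
      · rintro (h | h)
        · exact h.2 rfl
        · omega
    · by_cases hjb : j = b
      · subst hjb
        rw [hs.at_b, if_neg hbX, if_pos (Or.inr rfl)]
        omega
      · rw [hs.elsewhere j hja hjb]
        by_cases hjX : j ∈ X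
        · have := hXX j hjX
          rw [if_pos hjX, if_pos (Or.inl ⟨hjX, hja⟩)]
          omega
        · rw [if_neg hjX, if_neg (by tauto)]
          omega
  · rw [Finset.disjoint_left]
    rintro ⟨x, y⟩ h1 h2
    simp only [mem_image, mem_Icc, Prod.mk.injEq, mem_filter] at h1 h2
    obtain ⟨c, ⟨c1, c2⟩, rfl, rfl⟩ := h1
    obtain ⟨i, ⟨i1, i2⟩, rfl, rfl⟩ := h2
    have := nextIn_spec X b i (fun v hv => (hXX v hv).2.1) (hXX i i1).2.1
    omega

lemma tab_mem {α β : Partition n} {a b : ℕ} (hs : OneBoxShift α β a b) {X : Finset ℕ}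
    (hX : X ⊆ Rset α a b) (haX : a ∈ X) : tableauOfSet α a b X ∈ SSTSet α β.parts := by
  have ha := hs.a_pos
  have hb := hs.a_lt_b
  refine ⟨⟨?_, ?_⟩, tab_type hs hX haX, ?_⟩
  · intro i j j' hc hc' hjj
    by_cases h : i ∈ X ∧ j = α.parts i
    · have : j' ≤ α.parts i := hc'.2.2
      have : j = j' := by omega
      rw [this]
    · rw [tab_other hc (by tauto)]
      exact tab_ge ha hb hX hc'
  · intro i i' j hc hc' hii
    rw [tab_upper hb hX hc hc' hii]
    exact lt_of_lt_of_le hii (tab_ge ha hb hX hc')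
  · intro cc hcc
    unfold tableauOfSet
    rw [if_neg hcc]

lemma eval_tab {F : Type*} [Field F] {α β : Partition n} {Λ : (ℕ × ℕ → ℕ) → F}
    {U : (ℕ × ℕ → ℕ) → F} (hU : Functional α β Λ U) {a b : ℕ} (hs : OneBoxShift α β a b)
    {X : Finset ℕ} (hX : X ⊆ Rset α a b) (haX : a ∈ X) :
    U (tableauOfSet α a b X) = Λ (tableauOfSet α a b X) :=
  hU.eval _ (tab_mem hs hX haX) fun i j h h' => tab_upper hs.a_lt_b hX h h' (by omega)

/-- The basic linear relation between the coefficients. -/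
lemma step_relation {F : Type*} [Field F] {α β : Partition n} {Λ : (ℕ × ℕ → ℕ) → F}
    {U : (ℕ × ℕ → ℕ) → F} (hU : Functional α β Λ U) {a b : ℕ} (hs : OneBoxShift α β a b)
    {N : Finset ℕ} (hN : N ⊆ Rset α a b) (haN : a ∈ N) {u q : ℕ} (huR : u ∈ Rset α a b)
    (huN : u ∉ N) (hmax : ∀ v ∈ Rset α a b, u < v → v ∈ N)
    (hq : nextIn (insert u N) b u = q) :
    Λ (tableauOfSet α a b N) +
      ((α.parts u : F) - (α.parts q : F)) * Λ (tableauOfSet α a b (insert u N)) +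
      (if q < b then ((q : F) - (u : F)) * Λ (tableauOfSet α a b (insert u N)) -
        Λ (tableauOfSet α a b ((insert u N).erase q)) else 0) = 0 := by
  classical
  have ha := hs.a_pos
  have hb := hs.a_lt_b
  have hNN : ∀ v ∈ N, a ≤ v ∧ v < b ∧ α.parts (v + 1) < α.parts v :=
    fun v hv => (mem_Rset hb).1 (hN hv)
  have hNb : ∀ v ∈ N, v < b := fun v hv => (hNN v hv).2.1
  obtain ⟨hua, hub, hur⟩ := (mem_Rset hb).1 huR
  have hau : a < u := lt_of_le_of_ne hua (fun h => huN (h ▸ haN))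
  set Y := insert u N with hYdef
  have hY : Y ⊆ Rset α a b := Finset.insert_subset huR hN
  have haY : a ∈ Y := mem_insert_of_mem haN
  have huY : u ∈ Y := mem_insert_self _ _
  have hYb : ∀ v ∈ Y, v < b := fun v hv => ((mem_Rset hb).1 (hY hv)).2.1
  have hYN : ∀ v, v ∈ Y ↔ v = u ∨ v ∈ N := fun v => by rw [hYdef, mem_insert]
  obtain ⟨q1, q2, q3, q4⟩ := nextIn_spec Y b u hYb hub
  rw [hq] at q1 q2 q3 q4
  have hqN : q ∈ N ∨ q = b := by
    rcases q3 with h | h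
    · rcases (hYN q).1 h with h | h
      · omega
      · exact Or.inl h
    · exact Or.inr h
  have anti : ∀ i j, 0 < i → i ≤ j → α.parts j ≤ α.parts i := fun i j h h' => α.antitone h h'
  -- the parts are constant on `(u, q]`
  have hconst' : ∀ k w, u < w → w + k = q → α.parts w = α.parts q := by
    intro k
    induction k with
    | zero =>
      intro w _ e
      rw [← e, Nat.add_zero]
    | succ k ih =>
      intro w hw e
      have hwR : w ∉ Rset α a b := by
        intro h
        have := q4 w ((hYN w).2 (Or.inr (hmax w h hw))) hw
        omega
      rw [mem_Rset hb] at hwR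
      have h1 := anti w (w + 1) (by omega) (by omega)
      have h2 : ¬ α.parts (w + 1) < α.parts w := fun h => hwR ⟨by omega, by omega, h⟩
      have h3 := ih (w + 1) (by omega) (by omega)
      omega
  have hconst : ∀ w, u < w → w ≤ q → α.parts w = α.parts q :=
    fun w hw hwq => hconst' (q - w) w hw (by omega)
  have hu1 : α.parts (u + 1) = α.parts q := hconst (u + 1) (by omega) (by omega)
  have hqu : α.parts q < α.parts u := by omega
  -- predecessor of `u`
  have hne : (N.filter fun i => i < u).Nonempty := ⟨a, by simp [haN, hau]⟩
  obtain ⟨m, hm, hmm⟩ := Finset.exists_max_image _ id hne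
  simp only [mem_filter, id] at hm hmm
  obtain ⟨hmN, hmu⟩ := hm
  have nextYm : nextIn Y b m = u := by
    refine nextIn_eq Y b m u hYb (hNb m hmN) hmu hub.le (Or.inl huY) ?_
    intro v hv hmv
    rcases (hYN v).1 hv with h | h
    · omega
    · by_contra hlt
      have := hmm v ⟨h, by omega⟩
      omega
  have nextNm : nextIn N b m = q := by
    refine nextIn_eq N b m q hNb (hNb m hmN) (by omega) q2 hqN ?_
    intro v hv hmv
    apply q4 v ((hYN v).2 (Or.inr hv))
    by_contra hlt
    have : v ≠ u := fun h => huN (h ▸ hv)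
    have := hmm v ⟨hv, by omega⟩
    omega
  have nextYN : ∀ i ∈ N, i ≠ m → nextIn Y b i = nextIn N b i := by
    intro i hi him
    obtain ⟨a1, a2, a3, a4⟩ := nextIn_spec N b i hNb (hNb i hi)
    refine nextIn_eq Y b i _ hYb (hNb i hi) a1 a2 (by
      rcases a3 with h | h
      · exact Or.inl ((hYN _).2 (Or.inr h))
      · exact Or.inr h) ?_
    intro v hv hiv
    rcases (hYN v).1 hv with h | h
    · subst h
      have := hmm i ⟨hi, hiv⟩
      have := a4 m hmN (by omega)
      omega
    · exact a4 v h hiv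
  -- the fillings
  set T := tableauOfSet α a b Y with hT
  set e : ℕ × ℕ := (u, α.parts u) with he
  set G := Function.update T e u with hG
  have hTG : T = Function.update G e q := by
    have : T e = q := by rw [hT, he, tab_end ha hb hY huY, hq]
    rw [hG, Function.update_idem, ← this, Function.update_eq_self]
  have Gend : ∀ i ∈ N, G (i, α.parts i) = nextIn Y b i := by
    intro i hi
    have : (i, α.parts i) ≠ e := by
      intro h; rw [he, Prod.mk.injEq] at h; exact huN (h.1 ▸ hi)
    rw [hG, Function.update_of_ne this, hT, tab_end ha hb hY ((hYN i).2 (Or.inr hi))]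
  have Goth : ∀ i j, (i, j) ∈ α.cells → (i ∈ N → j ≠ α.parts i) → G (i, j) = i := by
    intro i j hc h
    by_cases hh : (i, j) = e
    · rw [hh, hG, Function.update_self]
      rw [he, Prod.mk.injEq] at hh; exact hh.1.symm
    · rw [hG, Function.update_of_ne hh, hT, tab_other hc]
      intro hi hj
      rcases (hYN i).1 hi with h' | h'
      · apply hh; rw [he, h', hj, h']
      · exact h h' hj
  have cell : ∀ i j, 0 < i → 0 < j → j ≤ α.parts i → (i, j) ∈ α.cells :=
    fun i j h1 h2 h3 => ⟨h1, h2, h3⟩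
  have ecell : e ∈ α.cells := cell u _ (by omega) (by omega) le_rfl
  -- rows above `u` in columns at most `α_u`
  have Gabove : ∀ i j, 0 < i → i < u → 0 < j → j ≤ α.parts u → G (i, j) = i := by
    intro i j h1 h2 h3 h4
    have h5 := anti i u h1 h2.le
    apply Goth i j (cell i j h1 h3 (by omega))
    intro hi hj
    have h6 := (hNN i hi).2.2
    have h7 := anti (i + 1) u (by omega) (by omega)
    omega
  have Gq : ∀ j, 0 < j → j ≤ α.parts q → (q < b → j ≠ α.parts q) → G (q, j) = q := by
    intro j h1 h2 h3
    apply Goth q j (cell q j (by omega) h1 h2)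
    intro hqN
    exact h3 (hNb q hqN)
  have hUTN : U (tableauOfSet α a b N) = U (Function.update G (m, α.parts m) q) := by
    apply hU.congr
    rintro ⟨i, j⟩ hc
    by_cases h : i ∈ N ∧ j = α.parts i
    · obtain ⟨h1, rfl⟩ := h
      rw [tab_end ha hb hN h1]
      by_cases him : i = m
      · subst him; rw [Function.update_self, nextNm]
      · rw [Function.update_of_ne (by simp [him]), Gend i h1, nextYN i h1 him]
    · rw [tab_other hc (by tauto), Function.update_of_ne, Goth i j hc (by tauto)]
      intro h'
      rw [Prod.mk.injEq] at h'
      obtain ⟨rfl, rfl⟩ := h'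
      exact h ⟨hmN, rfl⟩
  -- swaps of `e` with an entry in a row above `u` give zero
  have kill : ∀ (H : ℕ × ℕ → ℕ) (i j : ℕ), 0 < i → i < u → 0 < j → j < α.parts u →
      (∀ i' j', i' < u → H (i', j') = G (i', j')) → U (H ∘ Equiv.swap e (i, j)) = 0 := by
    intro H i j h1 h2 h3 h4 hH
    have h5 := anti i u h1 h2.le
    apply hU.rep _ i u (α.parts u) (cell _ _ h1 (by omega) (by omega)) ecell (by omega)
    simp only [Function.comp]
    rw [← he, Equiv.swap_apply_left, Equiv.swap_apply_of_ne_of_ne, hH _ _ h2, hH _ _ h2,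
      Gabove i j h1 h2 h3 h4.le, Gabove i _ h1 h2 (by omega) le_rfl]
    · rw [he]; intro h; rw [Prod.mk.injEq] at h; omega
    · intro h; rw [Prod.mk.injEq] at h; omega
  have Gu : ∀ j, 0 < j → j ≤ α.parts u → G (u, j) = u := by
    intro j h1 h2
    exact Goth u j (cell u j (by omega) h1 h2) (fun h => absurd h huN)
  -- columns of length `u`
  have col1 : ∀ j, α.parts q < j → j ≤ α.parts u → U (Function.update G (u, j) q) = U T := by
    intro j h1 h2
    rcases Nat.lt_or_eq_of_le h2 with h3 | h3
    · rw [hU.garnir _ e j ecell (by omega) h3, Finset.sum_eq_single (u, j)]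
      · congr 1
        rw [hTG]
        funext c
        simp only [Function.comp]
        have hne : e ≠ (u, j) := by
          rw [he]; intro h; rw [Prod.mk.injEq] at h; omega
        by_cases hc : c = e
        · rw [hc, Equiv.swap_apply_left, Function.update_self, Function.update_self]
        · by_cases hc' : c = (u, j)
          · rw [hc', Equiv.swap_apply_right, Function.update_of_ne hne,
              Function.update_of_ne hne.symm, Gu j (by omega) h2, he, Gu _ (by omega) le_rfl]
          · rw [Equiv.swap_apply_of_ne_of_ne hc hc', Function.update_of_ne hc,
              Function.update_of_ne hc']
      · rintro ⟨i, j'⟩ hij hne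
        simp only [mem_filter, mem_cellFinset] at hij
        obtain ⟨⟨c1, c2, c3⟩, rfl⟩ := hij
        simp only at c1 c2 c3
        have hiu : i ≠ u := by rintro rfl; exact hne rfl
        have hiu' : i < u := by
          by_contra hlt
          have := anti (u + 1) i (by omega) (by omega)
          omega
        apply kill _ i j' c1 hiu' c2 h3
        intro i' j'' hi'
        rw [Function.update_of_ne]
        intro h; rw [Prod.mk.injEq] at h; omega
      · intro h
        exfalso; apply h
        simp only [mem_filter, mem_cellFinset, and_true]
        exact cell u j (by omega) (by omega) h2
    · rw [hTG, he, h3]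
  -- long columns
  have col2 : ∀ j, 0 < j → j ≤ α.parts q → (q < b → j ≠ α.parts q) →
      U (Function.update G (u, j) q) = 0 := by
    intro j h1 h2 h3
    apply hU.rep _ u q j (cell _ _ (by omega) h1 (by omega)) (cell _ _ (by omega) h1 h2) (by omega)
    rw [Function.update_self, Function.update_of_ne, Gq j h1 h2 h3]
    intro h; rw [Prod.mk.injEq] at h; omega
  -- the column of the end of row `q`
  have col3 : q < b → U (Function.update G (u, α.parts q) q) =
      ((q : F) - (u : F)) * U T - U (tableauOfSet α a b (Y.erase q)) := by
    intro hqb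
    have hqN' : q ∈ N := by
      rcases hqN with h | h
      · exact h
      · omega
    obtain ⟨qa, -, hqr⟩ := hNN q hqN'
    set c := α.parts q with hc
    have hc0 : 0 < c := by omega
    have hwN : ∀ w, u < w → w < q → w ∉ N := by
      intro w h1 h2 h
      have := q4 w ((hYN w).2 (Or.inr h)) h1
      omega
    have hec : ∀ i, e ≠ (i, c) := by
      intro i h; rw [he, Prod.mk.injEq] at h; omega
    have ccell : ∀ i, 0 < i → i ≤ q → (i, c) ∈ α.cells := by
      intro i h1 h2
      exact cell i c h1 hc0 (anti i q h1 h2)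
    rw [hU.garnir _ e c ecell hc0 (by rw [he]; exact hqu)]
    have hfilter : (cellFinset α).filter (fun y => y.2 = c) = (Icc 1 q).image fun i => (i, c) := by
      ext ⟨i, j⟩
      simp only [mem_filter, mem_cellFinset, mem_image, mem_Icc, Prod.mk.injEq]
      constructor
      · rintro ⟨⟨c1, c2, c3⟩, rfl⟩
        simp only at c1 c2 c3
        refine ⟨i, ⟨c1, ?_⟩, rfl, rfl⟩
        by_contra hlt
        have := anti (q + 1) i (by omega) (by omega)
        omega
      · rintro ⟨i, ⟨h1, h2⟩, rfl, rfl⟩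
        exact ⟨ccell i h1 h2, rfl⟩
    rw [hfilter, Finset.sum_image (fun x _ y _ h => by simpa using h)]
    have vabove : ∀ i, 0 < i → i < u →
        U (Function.update G (u, c) q ∘ Equiv.swap e (i, c)) = 0 := by
      intro i h1 h2
      apply kill _ i c h1 h2 hc0 hqu
      intro i' j'' hi'
      rw [Function.update_of_ne]
      intro h; rw [Prod.mk.injEq] at h; omega
    have vu : U (Function.update G (u, c) q ∘ Equiv.swap e (u, c)) = U T := by
      congr 1
      rw [hTG]
      funext d
      simp only [Function.comp]
      by_cases hd : d = e
      · rw [hd, Equiv.swap_apply_left, Function.update_self, Function.update_self]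
      · by_cases hd' : d = (u, c)
        · rw [hd', Equiv.swap_apply_right, Function.update_of_ne (hec u),
            Function.update_of_ne (hec u).symm, Gu c hc0 hqu.le, he, Gu _ (by omega) le_rfl]
        · rw [Equiv.swap_apply_of_ne_of_ne hd hd', Function.update_of_ne hd,
            Function.update_of_ne hd']
    -- general form of the swap with a lower row
    have vlow : ∀ w, u < w → w ≤ q →
        U (Function.update G (u, c) q ∘ Equiv.swap e (w, c)) =
          - U (Function.update (Function.update G e (G (w, c))) (w, c) q) := by
      intro w h1 h2
      have hwu : (w, c) ≠ (u, c) := by intro h; rw [Prod.mk.injEq] at h; omega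
      rw [eq_neg_iff_add_eq_zero, add_comm, ← eq_neg_iff_add_eq_zero,
        ← hU.swap _ u w c (ccell u (by omega) (by omega)) (ccell w (by omega) h2) (by omega)]
      congr 1
      funext d
      simp only [Function.comp]
      by_cases hd : d = e
      · rw [hd, Equiv.swap_apply_of_ne_of_ne (hec u) (hec w), Equiv.swap_apply_left,
          Function.update_of_ne (hec w), Function.update_self, Function.update_of_ne hwu]
      · by_cases hd' : d = (u, c)
        · rw [hd', Equiv.swap_apply_left, Equiv.swap_apply_right, Function.update_of_ne hwu.symm,
            Function.update_of_ne (hec u).symm, Function.update_of_ne (hec u), Gu c hc0 hqu.le, he,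
            Gu _ (by omega) le_rfl]
        · by_cases hd'' : d = (w, c)
          · rw [hd'', Equiv.swap_apply_right, Equiv.swap_apply_of_ne_of_ne (hec u).symm hwu.symm,
              Function.update_self, Function.update_self]
          · rw [Equiv.swap_apply_of_ne_of_ne hd' hd'', Equiv.swap_apply_of_ne_of_ne hd hd'',
              Function.update_of_ne hd'', Function.update_of_ne hd, Function.update_of_ne hd']
    have vmid : ∀ w, u < w → w < q →
        U (Function.update G (u, c) q ∘ Equiv.swap e (w, c)) = U T := by
      intro w h1 h2
      have hwc : α.parts w = c := hconst w h1 h2.le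
      have hGw : ∀ j, 0 < j → j ≤ c → G (w, j) = w := by
        intro j h3 h4
        exact Goth w j (cell w j (by omega) h3 (by omega)) (fun h => absurd h (hwN w h1 h2))
      rw [vlow w h1 h2.le, hGw c hc0 le_rfl]
      have hr := hU.raise (Function.update G e w) w q (by omega) h2
      have hset : (cellFinset α).filter (fun d => Function.update G e w d = w) =
          insert e ((Icc 1 c).image fun j => (w, j)) := by
        ext ⟨i, j⟩
        simp only [mem_filter, mem_cellFinset, mem_insert, mem_image, mem_Icc, Prod.mk.injEq]
        constructor
        · rintro ⟨hcell, hv⟩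
          by_cases hd : (i, j) = e
          · exact Or.inl hd
          · right
            rw [Function.update_of_ne hd] at hv
            by_cases h : i ∈ N ∧ j = α.parts i
            · exfalso
              obtain ⟨h3, rfl⟩ := h
              rw [Gend i h3] at hv
              obtain ⟨-, -, a3, -⟩ := nextIn_spec Y b i hYb (hNb i h3)
              rw [hv] at a3
              rcases a3 with h | h
              · rcases (hYN w).1 h with h | h
                · omega
                · exact hwN w h1 h2 h
              · omega
            · rw [Goth i j hcell (by tauto)] at hv
              subst hv
              have h5 : j ≤ α.parts i := hcell.2.2
              exact ⟨j, ⟨hcell.2.1, by omega⟩, rfl, rfl⟩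
        · rintro (h | ⟨j, ⟨h3, h4⟩, rfl, rfl⟩)
          · rw [h]; exact ⟨ecell, Function.update_self ..⟩
          · refine ⟨cell w j (by omega) h3 (by omega), ?_⟩
            rw [Function.update_of_ne, hGw j h3 h4]
            rw [he]; intro h; rw [Prod.mk.injEq] at h; omega
      rw [hset, Finset.sum_insert, Finset.sum_image (fun x _ y _ h => by simpa using h),
        Finset.sum_eq_single c] at hr
      · rw [Function.update_idem, ← hTG] at hr
        linear_combination -hr
      · intro j hj hjc
        rw [mem_Icc] at hj
        apply hU.rep _ w q j (cell w j (by omega) (by omega) (by omega))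
          (cell q j (by omega) (by omega) (by omega)) (by omega)
        rw [Function.update_self, Function.update_of_ne, Function.update_of_ne,
          Gq j (by omega) hj.2 (fun _ => hjc)]
        · rw [he]; intro h; rw [Prod.mk.injEq] at h; omega
        · intro h; rw [Prod.mk.injEq] at h; omega
      · intro h; exfalso; apply h; rw [mem_Icc]; omega
      · intro h
        simp only [mem_image, he, Prod.mk.injEq] at h
        obtain ⟨j, -, h5, -⟩ := h
        omega
    have vq : U (Function.update G (u, c) q ∘ Equiv.swap e (q, c)) =
        - U (tableauOfSet α a b (Y.erase q)) := by
      rw [vlow q q1 le_rfl]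
      congr 1
      apply hU.congr
      have hZ : Y.erase q ⊆ Rset α a b := (Finset.erase_subset _ _).trans hY
      have hZb : ∀ v ∈ Y.erase q, v < b := fun v hv => hYb v (Finset.mem_of_mem_erase hv)
      obtain ⟨r1, r2, r3, r4⟩ := nextIn_spec Y b q hYb hqb
      have nextZu : nextIn (Y.erase q) b u = nextIn Y b q := by
        refine nextIn_eq _ b u _ hZb hub (by omega) r2 ?_ ?_
        · rcases r3 with h | h
          · exact Or.inl (Finset.mem_erase.2 ⟨by omega, h⟩)
          · exact Or.inr h
        · intro v hv huv
          rw [Finset.mem_erase] at hv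
          have := q4 v hv.2 huv
          exact r4 v hv.2 (by omega)
      have nextZ : ∀ i ∈ N, i ≠ q → nextIn (Y.erase q) b i = nextIn Y b i := by
        intro i hi hiq
        obtain ⟨s1, s2, s3, s4⟩ := nextIn_spec Y b i hYb (hNb i hi)
        refine nextIn_eq _ b i _ hZb (hNb i hi) s1 s2 ?_ ?_
        · rcases s3 with h | h
          · refine Or.inl (Finset.mem_erase.2 ⟨?_, h⟩)
            intro hh
            have h6 := s4 u huY
            have h7 : i ≠ u := fun h => huN (h ▸ hi)
            by_cases hiu : i < u
            · have := h6 hiu; omega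
            · have := q4 i ((hYN i).2 (Or.inr hi)) (by omega)
              omega
          · exact Or.inr h
        · intro v hv hiv
          exact s4 v (Finset.mem_of_mem_erase hv) hiv
      rintro ⟨i, j⟩ hcell
      by_cases hd : (i, j) = (q, c)
      · rw [hd, Function.update_self, tab_other (ccell q (by omega) le_rfl)]
        intro h; exact absurd h (Finset.notMem_erase _ _)
      · rw [Function.update_of_ne hd]
        by_cases hd' : (i, j) = e
        · have huZ : u ∈ Y.erase q := Finset.mem_erase.2 ⟨by omega, huY⟩
          rw [hd', Function.update_self, hc, Gend q hqN', he, tab_end ha hb hZ huZ, nextZu]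
        · rw [Function.update_of_ne hd']
          by_cases h : i ∈ N ∧ j = α.parts i
          · obtain ⟨h3, rfl⟩ := h
            have hiq : i ≠ q := by
              rintro rfl; exact hd rfl
            rw [Gend i h3, tab_end ha hb hZ (Finset.mem_erase.2 ⟨hiq, (hYN i).2 (Or.inr h3)⟩),
              nextZ i h3 hiq]
          · rw [Goth i j hcell (by tauto), tab_other hcell]
            intro hi hj
            rcases (hYN i).1 (Finset.mem_of_mem_erase hi) with h' | h'
            · apply hd'; rw [he, hj, h']
            · exact h ⟨h', hj⟩
    have hsplit : ∀ i ∈ Icc 1 q, U (Function.update G (u, c) q ∘ Equiv.swap e (i, c)) =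
        (if i ∈ Ico u q then U T else 0) +
          (if i = q then - U (tableauOfSet α a b (Y.erase q)) else 0) := by
      intro i hi
      rw [mem_Icc] at hi
      by_cases h1 : i < u
      · rw [vabove i (by omega) h1, if_neg (by rw [mem_Ico]; omega), if_neg (by omega), add_zero]
      · by_cases h2 : i = q
        · rw [if_neg (by rw [mem_Ico]; omega), if_pos h2, h2, vq, zero_add]
        · rw [if_pos (by rw [mem_Ico]; omega), if_neg h2, add_zero]
          by_cases h3 : i = u
          · rw [h3, vu]
          · exact vmid i (by omega) (by omega)
    rw [Finset.sum_congr rfl hsplit, Finset.sum_add_distrib, Finset.sum_ite_eq', if_pos,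
      ← Finset.sum_filter, Finset.sum_const]
    · have : (Icc 1 q).filter (fun i => i ∈ Ico u q) = Ico u q := by
        ext i; simp only [mem_filter, mem_Icc, mem_Ico]; omega
      rw [this, Nat.card_Ico, nsmul_eq_mul, Nat.cast_sub q1.le]
      ring
    · rw [mem_Icc]; omega
  -- the main relation
  have hr := hU.raise G u q (by omega) q1
  have hset : (cellFinset α).filter (fun d => G d = u) =
      insert (m, α.parts m) ((Icc 1 (α.parts u)).image fun j => (u, j)) := by
    ext ⟨i, j⟩
    simp only [mem_filter, mem_cellFinset, mem_insert, mem_image, mem_Icc, Prod.mk.injEq]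
    constructor
    · rintro ⟨hcell, hv⟩
      by_cases h : i ∈ N ∧ j = α.parts i
      · obtain ⟨h3, rfl⟩ := h
        rw [Gend i h3] at hv
        obtain ⟨s1, s2, s3, s4⟩ := nextIn_spec Y b i hYb (hNb i h3)
        have h4 := hmm i ⟨h3, by omega⟩
        have : i = m := by
          by_contra hne
          have := s4 m ((hYN m).2 (Or.inr hmN)) (by omega)
          omega
        subst this
        exact Or.inl ⟨rfl, rfl⟩
      · rw [Goth i j hcell (by tauto)] at hv
        subst hv
        exact Or.inr ⟨j, ⟨hcell.2.1, hcell.2.2⟩, rfl, rfl⟩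
    · rintro (⟨rfl, rfl⟩ | ⟨j, ⟨h3, h4⟩, rfl, rfl⟩)
      · have := hNN i hmN
        exact ⟨cell i _ (by omega) (by omega) le_rfl, by rw [Gend i hmN, nextYm]⟩
      · exact ⟨cell u j (by omega) h3 h4, Gu j h3 h4⟩
  have hnm : (m, α.parts m) ∉ (Icc 1 (α.parts u)).image fun j => (u, j) := by
    intro h
    simp only [mem_image, Prod.mk.injEq] at h
    obtain ⟨j, -, h5, -⟩ := h
    omega
  rw [hset, Finset.sum_insert hnm, Finset.sum_image (fun x _ y _ h => by simpa using h),
    ← hUTN] at hr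
  have hsplit : ∀ j ∈ Icc 1 (α.parts u), U (Function.update G (u, j) q) =
      (if j ∈ Ioc (α.parts q) (α.parts u) then U T else 0) +
        (if j = α.parts q then (if q < b then ((q : F) - (u : F)) * U T -
          U (tableauOfSet α a b (Y.erase q)) else 0) else 0) := by
    intro j hj
    rw [mem_Icc] at hj
    by_cases h1 : α.parts q < j
    · rw [col1 j h1 hj.2, if_pos (by rw [mem_Ioc]; omega), if_neg (by omega), add_zero]
    · rw [if_neg (by rw [mem_Ioc]; omega), zero_add]
      by_cases h2 : j = α.parts q
      · rw [if_pos h2]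
        by_cases h3 : q < b
        · rw [if_pos h3, h2, col3 h3]
        · rw [if_neg h3, col2 j (by omega) (by omega) (fun h => absurd h h3)]
      · rw [if_neg h2, col2 j (by omega) (by omega) (fun _ => h2)]
  have hZ : Y.erase q ⊆ Rset α a b := (Finset.erase_subset _ _).trans hY
  have haZ : a ∈ Y.erase q := Finset.mem_erase.2 ⟨by omega, haY⟩
  rw [Finset.sum_congr rfl hsplit, Finset.sum_add_distrib, Finset.sum_ite_eq',
    ← Finset.sum_filter, Finset.sum_const, eval_tab hU hs hN haN, hT, eval_tab hU hs hY haY,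
    eval_tab hU hs hZ haZ] at hr
  have hcard : (Icc 1 (α.parts u)).filter (fun i => i ∈ Ioc (α.parts q) (α.parts u)) =
      Ioc (α.parts q) (α.parts u) := by
    ext i; simp only [mem_filter, mem_Icc, mem_Ioc]; omega
  rw [hcard, Nat.card_Ioc, nsmul_eq_mul, Nat.cast_sub hqu.le] at hr
  rw [add_assoc, hT]
  by_cases h3 : q < b
  · have hqN' : q ∈ N := by
      rcases hqN with h | h
      · exact h
      · omega
    have := (hNN q hqN').2.2
    rw [if_pos (by rw [mem_Icc]; omega)] at hr
    exact hr
  · rw [if_neg h3, ite_self] at hr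
    rw [if_neg h3]
    exact hr

lemma step_hook {F : Type*} [Field F] {α β : Partition n} {Λ : (ℕ × ℕ → ℕ) → F}
    {U : (ℕ × ℕ → ℕ) → F} (hU : Functional α β Λ U) {a b : ℕ} (hs : OneBoxShift α β a b)
    (k : ℕ) : ∀ (N : Finset ℕ) (u : ℕ), b - u ≤ k → N ⊆ Rset α a b → a ∈ N → u ∈ Rset α a b →
      u ∉ N → (∀ v ∈ Rset α a b, u < v → v ∈ N) →
      Λ (tableauOfSet α a b N) =
        - ((hook α b u : ℤ) : F) * Λ (tableauOfSet α a b (insert u N)) := by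
  have hb := hs.a_lt_b
  have ha := hs.a_pos
  induction k with
  | zero =>
    intro N u hk hN haN huR
    have := (mem_Rset hb).1 huR
    omega
  | succ k ih =>
    intro N u hk hN haN huR huN hmax
    have h := step_relation hU hs hN haN huR huN hmax rfl
    obtain ⟨hua, hub, hur⟩ := (mem_Rset hb).1 huR
    have hY : insert u N ⊆ Rset α a b := Finset.insert_subset huR hN
    obtain ⟨q1, q2, q3, q4⟩ := nextIn_spec (insert u N) b u
      (fun v hv => ((mem_Rset hb).1 (hY hv)).2.1) hub
    generalize nextIn (insert u N) b u = q at *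
    by_cases hqb : q < b
    · have hqY : q ∈ insert u N := by
        rcases q3 with h | h
        · exact h
        · omega
      rw [if_pos hqb] at h
      have h2 := ih ((insert u N).erase q) q (by omega) ((Finset.erase_subset _ _).trans hY)
        (Finset.mem_erase.2 ⟨by omega, mem_insert_of_mem haN⟩) (hY hqY)
        (Finset.notMem_erase _ _) (by
          intro v hv hqv
          exact Finset.mem_erase.2 ⟨by omega, mem_insert_of_mem (hmax v hv (by omega))⟩)
      rw [Finset.insert_erase hqY] at h2
      rw [h2] at h
      unfold hook at h ⊢
      rw [if_pos hqb] at h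
      rw [if_pos hub]
      push_cast at h ⊢
      linear_combination h
    · have hqb' : q = b := by omega
      have hu : u = b - 1 := by
        by_contra hne
        have hR : b - 1 ∈ Rset α a b := by
          rw [mem_Rset hb]
          refine ⟨by omega, by omega, ?_⟩
          have e : b - 1 + 1 = b := by omega
          rw [e]; exact hs.add
        have := q4 (b - 1) (mem_insert_of_mem (hmax _ hR (by omega))) (by omega)
        omega
      rw [if_neg hqb, hqb'] at h
      unfold hook
      rw [if_pos hub]
      have hbu : (b : F) = u + 1 := by
        have : b = u + 1 := by omega
        rw [this]; push_cast; ring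
      push_cast
      rw [hbu]
      linear_combination h

lemma final_step {F : Type*} [Field F] {α β : Partition n} {Λ : (ℕ × ℕ → ℕ) → F}
    {U : (ℕ × ℕ → ℕ) → F} (hU : Functional α β Λ U) {a b : ℕ} (hs : OneBoxShift α β a b)
    (k : ℕ) : ∀ (N : Finset ℕ), (Rset α a b \ N).card = k → N ⊆ Rset α a b → a ∈ N →
      (-1 : F) ^ N.card * Λ (tableauOfSet α a b N) =
      (-1 : F) ^ (Rset α a b).card *
        ((∏ u ∈ Rset α a b \ N, hook α b u : ℤ) : F) *
          Λ (tableauOfSet α a b (Rset α a b)) := by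
  induction k with
  | zero =>
    intro N hk hN haN
    rw [Finset.card_eq_zero, Finset.sdiff_eq_empty_iff_subset] at hk
    have : N = Rset α a b := Finset.Subset.antisymm hN hk
    rw [this]; simp
  | succ k ih =>
    intro N hk hN haN
    have hne : (Rset α a b \ N).Nonempty := by
      rw [← Finset.card_pos]; omega
    obtain ⟨u, hu, hum⟩ := Finset.exists_max_image _ id hne
    simp only [id] at hum
    rw [mem_sdiff] at hu
    have h1 := step_hook hU hs (b - u) N u le_rfl hN haN hu.1 hu.2 (by
      intro v hv huv
      by_contra hvN
      have := hum v (mem_sdiff.2 ⟨hv, hvN⟩)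
      omega)
    have hsd : Rset α a b \ insert u N = (Rset α a b \ N).erase u := by
      ext v; simp only [mem_sdiff, mem_insert, mem_erase]; tauto
    have huS : u ∈ Rset α a b \ N := mem_sdiff.2 hu
    have h2 := ih (insert u N) (by rw [hsd, Finset.card_erase_of_mem huS, hk]; rfl)
      (Finset.insert_subset hu.1 hN) (mem_insert_of_mem haN)
    rw [hsd, Finset.card_insert_of_notMem hu.2] at h2
    rw [← Finset.mul_prod_erase _ _ huS, h1]
    push_cast at h2 ⊢
    linear_combination ((hook α b u : ℤ) : F) * h2

/-- Let `F` be a field of characteristic `p > 2`, `β` a one-box-shift of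
`α` (from row `a` to row `b`), and `θ̂ = Σ_T Λ_T θ̂_T : S^α → S^β` an
`FΣ_n`-homomorphism.  Then for every removable `α`-set `{N}` of type `β`,
`(-1)^{|N|} Λ_N = (-1)^{|R|} (∏_{u ∈ {R}∖{N}} h_u) Λ_R`, where `{R}` is the full
removable set. -/
theorem stmt15 (F : Type*) [Field F] (p : ℕ) [CharP F p] (hp : 2 < p)
    {n : ℕ} (α β : Partition n) (a b : ℕ) (hshift : OneBoxShift α β a b)
    (θ : ↥(Specht F α) →ₗ[F] PermMod F n β.parts)
    (hθ : θ ∈ SpechtHom F α β.parts (Specht F β))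
    (Λ : (ℕ × ℕ → ℕ) → F)
    (hΛ : θ = ∑ T ∈ sstFinset α β, Λ T • thetaHat F α β.parts T)
    (N : Finset ℕ) (hNR : N ⊆ Rset α a b) (haN : a ∈ N) :
    (-1 : F) ^ N.card * Λ (tableauOfSet α a b N) =
      (-1 : F) ^ (Rset α a b).card *
        ((∏ u ∈ Rset α a b \ N, hook α b u : ℤ) : F) * Λ (tableauOfSet α a b (Rset α a b)) := by
  obtain ⟨U, hU⟩ := exists_functional F p hp α β θ hθ Λ hΛ
  exact final_step hU hshift _ N rfl hNR haN

end CarterPayne
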